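/- arXiv:1909.04772 — 3 statements merged into one kernel-verified Lean document; each statement's English description precedes it below -/
import Mathlib

section
/- Let f : ℝ^d → ℝ be a continuous integrable function with integrable Fourier transform, such that f(0) > 0, f̂(0) > 0, f(x) ≤ 0 whenever |x| ≥ r for some r > 0, and f̂(y) ≥ 0 for all y. Then for any lattice Λ ⊆ ℝ^d with minimal nonzero vector length at least r, the center density of the lattice packing, namely (r/2)^d / vol(ℝ^d/Λ), is at most f(0)/f̂(0) · (r/2)^d; equivalently, 1/vol(ℝ^d/Λ) ≤ f(0)/f̂(0). -/
open MeasureTheory FourierTransform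
open scoped Pointwise

/-- The character `x ↦ e^{2πi⟨t,x⟩}`. -/
noncomputable def lpCh {d : ℕ} (t x : EuclideanSpace ℝ (Fin d)) : ℂ :=
  (Real.fourierChar (inner ℝ t x) : ℂ)

lemma lpCh_norm {d : ℕ} (t x : EuclideanSpace ℝ (Fin d)) : ‖lpCh t x‖ = 1 := by
  exact Circle.norm_coe _

lemma lpCh_add {d : ℕ} (t x y : EuclideanSpace ℝ (Fin d)) :
    lpCh t (x + y) = lpCh t x * lpCh t y := by
  simp [lpCh, inner_add_right, AddChar.map_add_eq_mul]

lemma lpCh_neg {d : ℕ} (t x : EuclideanSpace ℝ (Fin d)) :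
    lpCh t (-x) = (starRingEnd ℂ) (lpCh t x) := by
  simp [lpCh, inner_neg_right, AddChar.map_neg_eq_inv]

lemma lpCh_cont {d : ℕ} :
    Continuous (fun p : EuclideanSpace ℝ (Fin d) × EuclideanSpace ℝ (Fin d) => lpCh p.1 p.2) := by
  unfold lpCh
  exact continuous_subtype_val.comp
    (Real.continuous_fourierChar.comp (continuous_fst.inner continuous_snd))

lemma lpCh_cont_right {d : ℕ} (t : EuclideanSpace ℝ (Fin d)) : Continuous fun x => lpCh t x :=
  lpCh_cont.comp (by fun_prop : Continuous fun x : EuclideanSpace ℝ (Fin d) => (t, x))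

lemma lpCh_cont_left {d : ℕ} (x : EuclideanSpace ℝ (Fin d)) : Continuous fun t => lpCh t x :=
  lpCh_cont.comp (by fun_prop : Continuous fun t : EuclideanSpace ℝ (Fin d) => (t, x))

lemma lp_inversion {d : ℕ} {f fhat : EuclideanSpace ℝ (Fin d) → ℝ}
    (hcont : Continuous f) (hint : Integrable f)
    (hFour : ∀ y, 𝓕 (fun x => (f x : ℂ)) y = (fhat y : ℂ))
    (hhatint : Integrable fhat) (x : EuclideanSpace ℝ (Fin d)) :
    (f x : ℂ) = ∫ t, (fhat t : ℂ) * lpCh t x := by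
  have h1 : 𝓕 (fun x => (f x : ℂ)) = fun y => (fhat y : ℂ) := funext hFour
  have h := Continuous.fourierInv_fourier_eq (f := fun x => (f x : ℂ))
    (Complex.continuous_ofReal.comp hcont) hint.ofReal (by rw [h1]; exact hhatint.ofReal)
  rw [h1] at h
  have h2 := congrFun h x
  rw [← h2, Real.fourierInv_eq]
  refine integral_congr_ae (Filter.Eventually.of_forall fun t => ?_)
  simp [lpCh, Circle.smul_def, mul_comm]

lemma lp_posdef {d : ℕ} {f fhat : EuclideanSpace ℝ (Fin d) → ℝ}
    (hinv : ∀ x, (f x : ℂ) = ∫ t, (fhat t : ℂ) * lpCh t x)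
    (hhatint : Integrable fhat) (μ : Measure (EuclideanSpace ℝ (Fin d))) [IsFiniteMeasure μ] :
    ∫ p, f (p.1 - p.2) ∂(μ.prod μ) = ∫ t, fhat t * ‖∫ x, lpCh t x ∂μ‖ ^ 2 := by
  have hmul : ∀ t, ((‖∫ x, lpCh t x ∂μ‖ ^ 2 : ℝ) : ℂ) =
      ∫ p, lpCh t (p.1 - p.2) ∂(μ.prod μ) := by
    intro t
    have : (fun p : EuclideanSpace ℝ (Fin d) × EuclideanSpace ℝ (Fin d) => lpCh t (p.1 - p.2)) =
        fun p => lpCh t p.1 * (starRingEnd ℂ) (lpCh t p.2) := by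
      funext p
      rw [sub_eq_add_neg, lpCh_add, lpCh_neg]
    rw [this, integral_prod_mul (fun x => lpCh t x) (fun y => (starRingEnd ℂ) (lpCh t y)),
      integral_conj, Complex.mul_conj, Complex.normSq_eq_norm_sq]
  have hI : Integrable (Function.uncurry fun (p : EuclideanSpace ℝ (Fin d) ×
      EuclideanSpace ℝ (Fin d)) (t : EuclideanSpace ℝ (Fin d)) =>
      (fhat t : ℂ) * lpCh t (p.1 - p.2)) ((μ.prod μ).prod volume) := by
    have h1 : Integrable (fun q : (EuclideanSpace ℝ (Fin d) × EuclideanSpace ℝ (Fin d)) ×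
        EuclideanSpace ℝ (Fin d) => (fhat q.2 : ℂ)) ((μ.prod μ).prod volume) :=
      (hhatint.ofReal (𝕜 := ℂ)).comp_snd (μ.prod μ)
    refine h1.mul_bdd (c := 1) ?_ ?_
    · exact (lpCh_cont.comp (by fun_prop : Continuous fun q : (EuclideanSpace ℝ (Fin d) ×
        EuclideanSpace ℝ (Fin d)) × EuclideanSpace ℝ (Fin d) =>
          (q.2, q.1.1 - q.1.2))).aestronglyMeasurable
    · exact Filter.Eventually.of_forall fun q => (lpCh_norm _ _).le
  have key : ((∫ p, f (p.1 - p.2) ∂(μ.prod μ) : ℝ) : ℂ) =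
      ((∫ t, fhat t * ‖∫ x, lpCh t x ∂μ‖ ^ 2 : ℝ) : ℂ) := by
    rw [← integral_complex_ofReal, ← integral_complex_ofReal]
    simp_rw [hinv]
    rw [integral_integral_swap hI]
    refine integral_congr_ae (Filter.Eventually.of_forall fun t => ?_)
    simp only
    rw [integral_const_mul, ← hmul]
    push_cast
    rfl
  exact_mod_cast key

/-- Lattice points of the box. -/
noncomputable def lpPt {d N : ℕ} {ι : Type} [Fintype ι]
    (b : Module.Basis ι ℝ (EuclideanSpace ℝ (Fin d))) (k : ι → Fin N) :
    EuclideanSpace ℝ (Fin d) := ∑ i, ((k i : ℕ) : ℝ) • b i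

lemma lpPt_repr {d N : ℕ} {ι : Type} [Fintype ι]
    (b : Module.Basis ι ℝ (EuclideanSpace ℝ (Fin d))) (k : ι → Fin N) (i : ι) :
    b.repr (lpPt b k) i = ((k i : ℕ) : ℝ) := by
  classical
  simp [lpPt, Finsupp.single_apply]

lemma lp_mem_smul {d N : ℕ} (hN : 0 < N) {ι : Type} [Fintype ι]
    (b : Module.Basis ι ℝ (EuclideanSpace ℝ (Fin d))) (x : EuclideanSpace ℝ (Fin d)) :
    x ∈ (N : ℝ) • ZSpan.fundamentalDomain b ↔ ∀ i, 0 ≤ b.repr x i ∧ b.repr x i < N := by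
  have hN' : (0 : ℝ) < N := by exact_mod_cast hN
  rw [Set.mem_smul_set_iff_inv_smul_mem₀ hN'.ne', ZSpan.mem_fundamentalDomain]
  refine forall_congr' fun i => ?_
  simp only [map_smul, Finsupp.smul_apply, smul_eq_mul, Set.mem_Ico]
  rw [inv_mul_lt_iff₀ hN', mul_one]
  refine and_congr_left fun _ => ?_
  constructor
  · intro h
    exact nonneg_of_mul_nonneg_right h (inv_pos.2 hN')
  · intro h; positivity

lemma lp_tiling {d N : ℕ} (hN : 0 < N) {ι : Type} [Fintype ι] [DecidableEq ι]
    (b : Module.Basis ι ℝ (EuclideanSpace ℝ (Fin d))) (h : EuclideanSpace ℝ (Fin d) → ℂ)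
    (hc : Continuous h) :
    ∫ x in (N : ℝ) • ZSpan.fundamentalDomain b, h x =
      ∑ k : ι → Fin N, ∫ x in ZSpan.fundamentalDomain b, h (lpPt b k + x) := by
  have hD : MeasurableSet (ZSpan.fundamentalDomain b) := ZSpan.fundamentalDomain_measurableSet b
  have hB : Bornology.IsBounded (ZSpan.fundamentalDomain b) := ZSpan.fundamentalDomain_isBounded b
  have hrw : ∀ k : ι → Fin N, ∀ x, (x ∈ (fun y => lpPt b k + y) '' ZSpan.fundamentalDomain b ↔
      ∀ i, ((k i : ℕ) : ℝ) ≤ b.repr x i ∧ b.repr x i < (k i : ℕ) + 1) := by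
    intro k x
    rw [Set.image_add_left, Set.mem_preimage, ZSpan.mem_fundamentalDomain]
    refine forall_congr' fun i => ?_
    simp only [map_add, map_neg, Finsupp.add_apply, Finsupp.neg_apply, lpPt_repr, Set.mem_Ico]
    constructor <;> rintro ⟨h1, h2⟩ <;> constructor <;> linarith
  have hU : (N : ℝ) • ZSpan.fundamentalDomain b =
      ⋃ k : ι → Fin N, (fun y => lpPt b k + y) '' ZSpan.fundamentalDomain b := by
    ext x
    rw [lp_mem_smul hN, Set.mem_iUnion]
    constructor
    · intro hx
      refine ⟨fun i => ⟨⌊b.repr x i⌋₊, (Nat.floor_lt (hx i).1).2 (hx i).2⟩, ?_⟩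
      rw [hrw]
      intro i
      exact ⟨Nat.floor_le (hx i).1, Nat.lt_floor_add_one _⟩
    · rintro ⟨k, hk⟩ i
      rw [hrw] at hk
      obtain ⟨h1, h2⟩ := hk i
      have h3 : ((k i : ℕ) : ℝ) + 1 ≤ N := by exact_mod_cast (k i).2
      exact ⟨le_trans (Nat.cast_nonneg _) h1, by linarith⟩
  rw [hU, integral_iUnion_fintype]
  · refine Finset.sum_congr rfl fun k _ => ?_
    exact (measurePreserving_add_left volume (lpPt b k)).setIntegral_image_emb
      (measurableEmbedding_addLeft _) _ _
  · intro k
    exact (measurableEmbedding_addLeft _).measurableSet_image.2 hD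
  · intro k l hkl
    refine Set.disjoint_left.2 fun x hx hy => hkl ?_
    rw [hrw] at hx hy
    funext i
    have h1 := hx i
    have h2 := hy i
    have h3 : ((k i : ℕ) : ℝ) < (l i : ℕ) + 1 := by linarith
    have h4 : ((l i : ℕ) : ℝ) < (k i : ℕ) + 1 := by linarith
    norm_cast at h3 h4
    ext
    omega
  · intro k
    have hb : Bornology.IsBounded ((fun y => lpPt b k + y) '' ZSpan.fundamentalDomain b) := by
      have := hB.vadd (lpPt b k)
      exact this
    exact (hc.continuousOn.integrableOn_compact hb.isCompact_closure).mono_set subset_closure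


lemma lp_ineq {d N : ℕ} (hN : 0 < N) {ι : Type} [Fintype ι] [DecidableEq ι]
    (b : Module.Basis ι ℝ (EuclideanSpace ℝ (Fin d)))
    {f fhat : EuclideanSpace ℝ (Fin d) → ℝ}
    (hinv : ∀ x, (f x : ℂ) = ∫ t, (fhat t : ℂ) * lpCh t x)
    (hhatint : Integrable fhat) (hpos : ∀ y, 0 ≤ fhat y)
    (hneg : ∀ k l : ι → Fin N, k ≠ l → f (lpPt b k - lpPt b l) ≤ 0)
    (hcont : Continuous f) :
    ∫ p, f (p.1 - p.2) ∂((volume.restrict ((N : ℝ) • ZSpan.fundamentalDomain b)).prod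
      (volume.restrict ((N : ℝ) • ZSpan.fundamentalDomain b))) ≤
      (volume.real (ZSpan.fundamentalDomain b)) ^ 2 * ((N : ℝ) ^ (Fintype.card ι) * f 0) := by
  set D := ZSpan.fundamentalDomain b with hDdef
  have hB : Bornology.IsBounded D := ZSpan.fundamentalDomain_isBounded b
  have hfin : volume D < ⊤ := hB.measure_lt_top
  have hfinN : volume ((N : ℝ) • D) < ⊤ := (hB.smul₀ (N : ℝ)).measure_lt_top
  have : IsFiniteMeasure (volume.restrict D) := ⟨by simpa using hfin⟩
  have : IsFiniteMeasure (volume.restrict ((N : ℝ) • D)) := ⟨by simpa using hfinN⟩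
  let μ : Measure (EuclideanSpace ℝ (Fin d)) := ∑ k : ι → Fin N, Measure.dirac (lpPt b k)
  have hμ : ∀ {F : Type} [NormedAddCommGroup F] [NormedSpace ℝ F] [CompleteSpace F]
      (g : EuclideanSpace ℝ (Fin d) → F),
      ∫ x, g x ∂μ = ∑ k : ι → Fin N, g (lpPt b k) := by
    intro F _ _ _ g
    rw [integral_finsetSum_measure]
    · simp
    · intro k _
      exact integrable_dirac (by simp)
  have hbdd : ∀ x, ‖f x‖ ≤ ∫ t, fhat t := by
    intro x
    rw [← Complex.norm_real, hinv]
    refine (norm_integral_le_integral_norm _).trans (le_of_eq ?_)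
    refine integral_congr_ae (Filter.Eventually.of_forall fun t => ?_)
    simp [lpCh_norm, abs_of_nonneg (hpos t)]
  have hS : ∫ p, f (p.1 - p.2) ∂(μ.prod μ) ≤ (N : ℝ) ^ (Fintype.card ι) * f 0 := by
    have hI : Integrable (fun p : EuclideanSpace ℝ (Fin d) × EuclideanSpace ℝ (Fin d) =>
        f (p.1 - p.2)) (μ.prod μ) := Integrable.of_bound (C := ∫ t, fhat t)
      (hcont.comp (continuous_fst.sub continuous_snd)).aestronglyMeasurable
      (Filter.Eventually.of_forall fun p => hbdd _)
    rw [integral_prod _ hI]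
    simp only [hμ]
    calc ∑ k : ι → Fin N, ∑ l : ι → Fin N, f (lpPt b k - lpPt b l)
        ≤ ∑ k : ι → Fin N, f 0 := by
          refine Finset.sum_le_sum fun k _ => ?_
          rw [← Finset.add_sum_erase _ _ (Finset.mem_univ k), sub_self]
          have : ∑ l ∈ Finset.univ.erase k, f (lpPt b k - lpPt b l) ≤ 0 :=
            Finset.sum_nonpos fun l hl => hneg k l (Finset.ne_of_mem_erase hl).symm
          linarith
      _ = _ := by simp
  rw [lp_posdef hinv hhatint] at hS ⊢
  refine le_trans ?_ (mul_le_mul_of_nonneg_left hS (sq_nonneg _))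
  rw [← integral_const_mul]
  have hle : ∀ t, ‖∫ x in (N : ℝ) • D, lpCh t x‖ ≤ volume.real D * ‖∫ x, lpCh t x ∂μ‖ := by
    intro t
    rw [lp_tiling hN b _ (lpCh_cont_right t), hμ]
    simp only [lpCh_add]
    simp only [integral_const_mul]
    rw [← Finset.sum_mul, norm_mul, mul_comm]
    refine mul_le_mul_of_nonneg_right ?_ (norm_nonneg _)
    have := norm_setIntegral_le_of_norm_le_const (f := fun x => lpCh t x) (C := 1) hfin
      (fun x _ => (lpCh_norm t x).le)
    simpa using this
  refine integral_mono_of_nonneg (Filter.Eventually.of_forall fun t =>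
    mul_nonneg (hpos t) (sq_nonneg _)) ?_ (Filter.Eventually.of_forall fun t => ?_)
  · refine Integrable.const_mul ?_ _
    refine hhatint.mul_bdd (c := (Fintype.card (ι → Fin N) : ℝ) ^ 2) ?_ ?_
    · simp only [hμ]
      refine Continuous.aestronglyMeasurable ?_
      refine (Continuous.norm ?_).pow 2
      exact continuous_finsetSum _ fun k _ => lpCh_cont_left (lpPt b k)
    · refine Filter.Eventually.of_forall fun t => ?_
      rw [norm_pow, norm_norm, hμ]
      refine pow_le_pow_left₀ (norm_nonneg _) ?_ 2
      refine (norm_sum_le _ _).trans ?_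
      simp [lpCh_norm]
  · simp only
    have h1 := pow_le_pow_left₀ (norm_nonneg _) (hle t) 2
    calc fhat t * ‖∫ x in (N : ℝ) • D, lpCh t x‖ ^ 2
        ≤ fhat t * (volume.real D * ‖∫ x, lpCh t x ∂μ‖) ^ 2 :=
          mul_le_mul_of_nonneg_left h1 (hpos t)
      _ = _ := by ring

lemma lp_limit {d : ℕ} {ι : Type} [Fintype ι]
    (b : Module.Basis ι ℝ (EuclideanSpace ℝ (Fin d)))
    {f : EuclideanSpace ℝ (Fin d) → ℝ} (hcont : Continuous f) (hint : Integrable f) :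
    Filter.Tendsto (fun N : ℕ => ∫ u in ZSpan.fundamentalDomain b,
      ∫ x in (N : ℝ) • ZSpan.fundamentalDomain b, f (x - (N : ℝ) • u)) Filter.atTop
      (nhds (volume.real (ZSpan.fundamentalDomain b) * ∫ x, f x)) := by
  set D := ZSpan.fundamentalDomain b with hDdef
  have hB : Bornology.IsBounded D := ZSpan.fundamentalDomain_isBounded b
  have hD : MeasurableSet D := ZSpan.fundamentalDomain_measurableSet b
  have hfin : volume D < ⊤ := hB.measure_lt_top
  have : IsFiniteMeasure (volume.restrict D) := ⟨by simpa using hfin⟩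
  have hconv : Convex ℝ D := by
    intro x hx y hy s t hs ht hst
    rw [hDdef, ZSpan.mem_fundamentalDomain] at *
    intro i
    have := (convex_Ico (0 : ℝ) 1) (hx i) (hy i) hs ht hst
    simpa using this
  have hlim : (volume.real D * ∫ x, f x) = ∫ u in D, ∫ x, f x := by simp
  rw [hlim]
  refine tendsto_integral_of_dominated_convergence (fun _ => ∫ x, ‖f x‖) ?_ ?_ ?_ ?_
  · intro N
    refine StronglyMeasurable.aestronglyMeasurable ?_
    have : SFinite (volume.restrict ((N : ℝ) • D)) := inferInstance
    refine StronglyMeasurable.integral_prod_right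
      (f := fun u x => f (x - (N : ℝ) • u)) (ν := volume.restrict ((N : ℝ) • D)) ?_
    refine Continuous.stronglyMeasurable ?_
    exact hcont.comp (by fun_prop : Continuous fun p : EuclideanSpace ℝ (Fin d) ×
      EuclideanSpace ℝ (Fin d) => p.2 - (N : ℝ) • p.1)
  · exact integrable_const _
  · intro N
    refine Filter.Eventually.of_forall fun u => ?_
    refine (norm_integral_le_integral_norm _).trans ?_
    refine (setIntegral_le_integral (hint.comp_sub_right _).norm
      (Filter.Eventually.of_forall fun x => norm_nonneg _)).trans (le_of_eq ?_)
    exact integral_sub_right_eq_self (fun x => ‖f x‖) _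
  · have hae : ∀ᵐ u ∂(volume.restrict D), u ∈ interior D := by
      have h0 : ∀ᵐ u ∂(volume : Measure (EuclideanSpace ℝ (Fin d))), u ∉ frontier D :=
        measure_eq_zero_iff_ae_notMem.1 (hconv.addHaar_frontier volume)
      filter_upwards [ae_restrict_of_ae h0, ae_restrict_mem hD] with u h1 h2
      by_contra h3
      exact h1 ⟨subset_closure h2, h3⟩
    filter_upwards [hae] with u hu
    have heq : ∀ᶠ N : ℕ in Filter.atTop, ∫ z, ((N : ℝ) • D).indicator (fun x => f (x - (N : ℝ) • u))
        (z + (N : ℝ) • u) = ∫ x in (N : ℝ) • D, f (x - (N : ℝ) • u) := by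
      filter_upwards [Filter.eventually_gt_atTop 0] with N hN
      rw [integral_add_right_eq_self (fun x => ((N : ℝ) • D).indicator
        (fun x => f (x - (N : ℝ) • u)) x) ((N : ℝ) • u), integral_indicator]
      exact hD.const_smul₀ _
    refine Filter.Tendsto.congr' heq ?_
    refine tendsto_integral_of_dominated_convergence (fun z => ‖f z‖) ?_ hint.norm ?_ ?_
    · intro N
      refine Measurable.aestronglyMeasurable ?_
      exact ((hcont.comp (continuous_id.sub continuous_const)).measurable.indicator
        (hD.const_smul₀ _)).comp (measurable_id.add_const _)
    · intro N
      refine Filter.Eventually.of_forall fun z => ?_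
      refine (norm_indicator_le_norm_self _ _).trans (le_of_eq ?_)
      simp
    · refine Filter.Eventually.of_forall fun z => ?_
      have ht : Filter.Tendsto (fun N : ℕ => (N : ℝ)⁻¹ • z + u) Filter.atTop (nhds u) := by
        have := ((tendsto_inv_atTop_nhds_zero_nat (𝕜 := ℝ)).smul_const z).add_const u
        simpa using this
      have hev := ht.eventually (mem_interior_iff_mem_nhds.1 hu)
      refine tendsto_const_nhds.congr' ?_
      filter_upwards [hev, Filter.eventually_gt_atTop 0] with N h1 hN
      have hN' : (N : ℝ) ≠ 0 := by exact_mod_cast hN.ne'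
      rw [Set.indicator_of_mem]
      · simp
      · rw [Set.mem_smul_set_iff_inv_smul_mem₀ hN', smul_add, inv_smul_smul₀ hN']
        exact h1

/-- **Cohn–Elkies linear programming bound for lattice packings.**
If `f : ℝ^d → ℝ` is continuous and integrable, its Fourier transform `fhat` is integrable,
`f 0 > 0`, `fhat 0 > 0`, `f x ≤ 0` for `‖x‖ ≥ r`, and `fhat ≥ 0` everywhere, then for any
lattice `Λ ⊆ ℝ^d` whose nonzero vectors all have length at least `r`, we have
`1 / vol(ℝ^d/Λ) ≤ f 0 / fhat 0` (equivalently, the center density `(r/2)^d / covol` is at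
most `(f 0 / fhat 0) * (r/2)^d`). -/
theorem lp_bound_for_lattice_packings
    (d : ℕ) (f fhat : EuclideanSpace ℝ (Fin d) → ℝ) (r : ℝ) (hr : 0 < r)
    (hcont : Continuous f)
    (hint : Integrable f)
    (hFour : ∀ y, 𝓕 (fun x => (f x : ℂ)) y = (fhat y : ℂ))
    (hhatint : Integrable fhat)
    (hf0 : 0 < f 0) (hfhat0 : 0 < fhat 0)
    (hneg : ∀ x, r ≤ ‖x‖ → f x ≤ 0)
    (hpos : ∀ y, 0 ≤ fhat y)
    (Λ : Submodule ℤ (EuclideanSpace ℝ (Fin d)))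
    [DiscreteTopology Λ] [IsZLattice ℝ Λ]
    (hmin : ∀ x ∈ Λ, x ≠ 0 → r ≤ ‖x‖) :
    1 / ZLattice.covolume Λ ≤ f 0 / fhat 0 := by
  classical
  let b₀ := Module.Free.chooseBasis ℤ Λ
  let b := b₀.ofZLatticeBasis ℝ Λ
  have hcov : ZLattice.covolume Λ = volume.real (ZSpan.fundamentalDomain b) :=
    ZLattice.covolume_eq_measure_fundamentalDomain Λ volume
      (ZLattice.isAddFundamentalDomain b₀ volume)
  have hcpos : 0 < ZLattice.covolume Λ := ZLattice.covolume_pos Λ volume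
  have hinv := lp_inversion hcont hint hFour hhatint
  have hB : Bornology.IsBounded (ZSpan.fundamentalDomain b) := ZSpan.fundamentalDomain_isBounded b
  have h0 : fhat 0 = ∫ x, f x := by
    have h := hFour 0
    rw [Real.fourier_eq] at h
    simp only [inner_zero_right, neg_zero, AddChar.map_zero_eq_one, one_smul] at h
    rw [integral_complex_ofReal] at h
    exact_mod_cast h.symm
  have hmem : ∀ (N : ℕ) (k : Module.Free.ChooseBasisIndex ℤ Λ → Fin N), lpPt b k ∈ Λ := by
    intro N k
    refine Submodule.sum_mem _ fun i _ => ?_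
    have : ((k i : ℕ) : ℝ) • b i = (k i : ℕ) • (b₀ i : EuclideanSpace ℝ (Fin d)) := by
      rw [Nat.cast_smul_eq_nsmul, Module.Basis.ofZLatticeBasis_apply]
    rw [this]
    exact nsmul_mem (b₀ i).2 _
  have hoff : ∀ (N : ℕ) (k l : Module.Free.ChooseBasisIndex ℤ Λ → Fin N), k ≠ l →
      f (lpPt b k - lpPt b l) ≤ 0 := by
    intro N k l hkl
    refine hneg _ (hmin _ (Λ.sub_mem (hmem N k) (hmem N l)) fun h => hkl ?_)
    funext i
    have h1 := congrArg (fun x => b.repr x i) (sub_eq_zero.1 h)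
    simp only [lpPt_repr] at h1
    exact Fin.ext (by exact_mod_cast h1)
  have hbound : ∀ᶠ N : ℕ in Filter.atTop, ∫ u in ZSpan.fundamentalDomain b,
      ∫ x in (N : ℝ) • ZSpan.fundamentalDomain b, f (x - (N : ℝ) • u) ≤
      (volume.real (ZSpan.fundamentalDomain b)) ^ 2 * f 0 := by
    filter_upwards [Filter.eventually_gt_atTop 0] with N hN
    have hN' : (0 : ℝ) < N := by exact_mod_cast hN
    have h1 := lp_ineq hN b hinv hhatint hpos (hoff N) hcont
    have hfinN : volume ((N : ℝ) • ZSpan.fundamentalDomain b) < ⊤ :=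
      (hB.smul₀ (N : ℝ)).measure_lt_top
    have : IsFiniteMeasure (volume.restrict ((N : ℝ) • ZSpan.fundamentalDomain b)) :=
      ⟨by simpa using hfinN⟩
    have hI : Integrable (fun p : EuclideanSpace ℝ (Fin d) × EuclideanSpace ℝ (Fin d) =>
        f (p.1 - p.2)) ((volume.restrict ((N : ℝ) • ZSpan.fundamentalDomain b)).prod
      (volume.restrict ((N : ℝ) • ZSpan.fundamentalDomain b))) := by
      refine Integrable.of_bound (C := ∫ t, fhat t)
        (hcont.comp (continuous_fst.sub continuous_snd)).aestronglyMeasurable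
        (Filter.Eventually.of_forall fun p => ?_)
      rw [← Complex.norm_real, hinv]
      refine (norm_integral_le_integral_norm _).trans (le_of_eq ?_)
      refine integral_congr_ae (Filter.Eventually.of_forall fun t => ?_)
      simp [lpCh_norm, abs_of_nonneg (hpos t)]
    rw [integral_prod_symm _ hI] at h1
    have hsc := Measure.setIntegral_comp_smul_of_pos volume
      (fun y => ∫ x in (N : ℝ) • ZSpan.fundamentalDomain b, f (x - y))
      (ZSpan.fundamentalDomain b) hN'
    rw [hsc, smul_eq_mul, Module.finrank_eq_card_basis b, inv_mul_le_iff₀ (by positivity)]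
    refine h1.trans (le_of_eq (by ring))
  have hfinal := le_of_tendsto (lp_limit b hcont hint) hbound
  rw [← h0, ← hcov] at hfinal
  rw [div_le_div_iff₀ hcpos hfhat0]
  nlinarith
end

section
/- For a radial Schwartz function f on ℝ^d, the Mellin transform satisfies f̂^M(s) = π^{d/2−s} Γ(s/2)/Γ((d−s)/2) · f^M(d−s) for 0 < Re(s) < d, where f^M(s) = ∫₀^∞ f(x) x^{s−1} dx is the Mellin transform of the radial profile and f̂ is the d-dimensional Fourier transform. -/
open MeasureTheory FourierTransform Real Complex

open Set Filter Topology in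
lemma mfr_fubini (d : ℕ) (hd : 0 < d) (h : ℝ → ℂ) (hc : ContinuousOn h (Ioi 0)) (w : ℂ)
    (hw : 0 < w.re) (hm : MellinConvergent h ((d : ℂ) - 2 * w)) :
    mellin (fun t : ℝ => ∫ r in Ioi (0 : ℝ), (r ^ (d - 1) : ℝ) •
        (h r * cexp (-((π * r ^ 2 : ℝ) * (t : ℂ))))) w
      = (π : ℂ) ^ (-w) * Complex.Gamma w * mellin h ((d : ℂ) - 2 * w) := by
  have hpow : ∀ r : ℝ, 0 < r → (1 / ((π * r ^ 2 : ℝ) : ℂ)) ^ w * ((r ^ (d - 1) : ℝ) : ℂ)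
      = (π : ℂ) ^ (-w) * (r : ℂ) ^ ((d : ℂ) - 2 * w - 1) := by
    intro r hr
    have hr' : (r : ℂ) ≠ 0 := ofReal_ne_zero.2 hr.ne'
    have h1 : (1 / ((π * r ^ 2 : ℝ) : ℂ)) ^ w = (π : ℂ) ^ (-w) * (r : ℂ) ^ (-(2 * w)) := by
      rw [one_div, Complex.inv_cpow, ← Complex.cpow_neg, ofReal_mul,
        Complex.mul_cpow_ofReal_nonneg pi_pos.le (by positivity)]
      · congr 1
        rw [show -(2 * w) = (2 : ℕ) * (-w) by push_cast; ring, Complex.cpow_nat_mul',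
          ofReal_pow]
        · rw [Complex.arg_ofReal_of_nonneg hr.le]; simp [pi_pos]
        · rw [Complex.arg_ofReal_of_nonneg hr.le]; simp [pi_pos.le]
      · rw [Complex.arg_ofReal_of_nonneg (by positivity)]; exact pi_pos.ne
    have h2 : ((r ^ (d - 1) : ℝ) : ℂ) = (r : ℂ) ^ ((d : ℂ) - 1) := by
      rw [ofReal_pow, ← Complex.cpow_natCast, Nat.cast_sub hd, Nat.cast_one]
    rw [h1, h2, mul_assoc, ← Complex.cpow_add _ _ hr']
    congr 2; ring
  have hnorm : ∀ t : ℝ, 0 < t → ∀ r : ℝ, 0 < r →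
      ‖(t : ℂ) ^ (w - 1) * ((r ^ (d - 1) : ℝ) • (h r * cexp (-((π * r ^ 2 : ℝ) * (t : ℂ)))))‖
      = (r ^ (d - 1) * ‖h r‖) * (t ^ (w.re - 1) * rexp (-((π * r ^ 2) * t))) := by
    intro t ht r hr
    rw [norm_mul, norm_smul, norm_mul, Complex.norm_cpow_eq_rpow_re_of_pos ht,
      Complex.norm_exp, Real.norm_of_nonneg (by positivity)]
    have : (-((π * r ^ 2 : ℝ) * (t : ℂ))).re = -((π * r ^ 2) * t) := by
      rw [← ofReal_mul, ← ofReal_neg, ofReal_re]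
    rw [this]; simp; ring
  have hgi : ∀ r : ℝ, 0 < r → ∫ t in Ioi (0:ℝ), t ^ (w.re - 1) * rexp (-((π * r ^ 2) * t))
      = (1 / (π * r ^ 2)) ^ w.re * Real.Gamma w.re := fun r hr =>
    Real.integral_rpow_mul_exp_neg_mul_Ioi hw (by positivity)
  have hgI : ∀ r : ℝ, 0 < r → IntegrableOn
      (fun t : ℝ => t ^ (w.re - 1) * rexp (-((π * r ^ 2) * t))) (Ioi 0) := by
    intro r hr
    by_contra hcon
    have := hgi r hr
    rw [integral_undef hcon] at this
    have h3 := Real.Gamma_pos_of_pos hw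
    have : 0 < (1 / (π * r ^ 2)) ^ w.re * Real.Gamma w.re := by positivity
    linarith
  have hmeas : ContinuousOn (Function.uncurry fun (t r : ℝ) => (t : ℂ) ^ (w - 1) *
      ((r ^ (d - 1) : ℝ) • (h r * cexp (-((π * r ^ 2 : ℝ) * (t : ℂ)))))) (Ioi 0 ×ˢ Ioi 0) := by
    simp only [Function.uncurry_def]
    have c1 : ContinuousOn (fun p : ℝ × ℝ => (p.1 : ℂ) ^ (w - 1)) (Ioi 0 ×ˢ Ioi 0) := by
      refine ContinuousOn.cpow_const (by fun_prop) ?_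
      rintro ⟨t, r⟩ ⟨ht, hr⟩
      exact Complex.ofReal_mem_slitPlane.2 ht
    have c2 : ContinuousOn (fun p : ℝ × ℝ => h p.2) (Ioi 0 ×ˢ Ioi 0) :=
      hc.comp continuousOn_snd (fun p hp => hp.2)
    have c3 : ContinuousOn (fun p : ℝ × ℝ => cexp (-((π * p.2 ^ 2 : ℝ) * (p.1 : ℂ))))
      (Ioi 0 ×ˢ Ioi 0) := Continuous.continuousOn (by fun_prop)
    have c4 : ContinuousOn (fun p : ℝ × ℝ => p.2 ^ (d - 1))
      (Ioi 0 ×ˢ Ioi 0) := Continuous.continuousOn (by fun_prop)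
    exact ContinuousOn.mul c1 (ContinuousOn.smul c4 (ContinuousOn.mul c2 c3))
  have hint : Integrable (Function.uncurry fun (t r : ℝ) => (t : ℂ) ^ (w - 1) *
      ((r ^ (d - 1) : ℝ) • (h r * cexp (-((π * r ^ 2 : ℝ) * (t : ℂ))))))
      ((volume.restrict (Ioi 0)).prod (volume.restrict (Ioi 0))) := by
    have hae : AEStronglyMeasurable (Function.uncurry fun (t r : ℝ) => (t : ℂ) ^ (w - 1) *
      ((r ^ (d - 1) : ℝ) • (h r * cexp (-((π * r ^ 2 : ℝ) * (t : ℂ))))))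
      ((volume.restrict (Ioi 0)).prod (volume.restrict (Ioi 0))) := by
      rw [Measure.prod_restrict]
      exact hmeas.aestronglyMeasurable (measurableSet_Ioi.prod measurableSet_Ioi)
    rw [integrable_prod_iff' hae]
    constructor
    · refine (ae_restrict_iff' measurableSet_Ioi).2 ?_
      refine ae_of_all _ fun r hr => ?_
      have hcr : ContinuousOn (fun t : ℝ => (t : ℂ) ^ (w - 1) *
          ((r ^ (d - 1) : ℝ) • (h r * cexp (-((π * r ^ 2 : ℝ) * (t : ℂ)))))) (Ioi 0) :=
        hmeas.comp (f := fun t : ℝ => (t, r)) (by fun_prop) (fun t ht => ⟨ht, hr⟩)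
      refine Integrable.mono' ((hgI r hr).const_mul (r ^ (d - 1) * ‖h r‖))
        (hcr.aestronglyMeasurable measurableSet_Ioi) ?_
      refine (ae_restrict_iff' measurableSet_Ioi).2 (ae_of_all _ fun t ht => ?_)
      exact (hnorm t ht r hr).le
    · have := (hm.norm.const_mul (π ^ (-w.re) * Real.Gamma w.re))
      refine IntegrableOn.congr_fun this ?_ measurableSet_Ioi
      intro r hr
      have hr : 0 < r := hr
      simp only [Function.uncurry]
      rw [setIntegral_congr_fun measurableSet_Ioi (fun t ht => hnorm t ht r hr),
        integral_const_mul, hgi r hr]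
      have := congrArg norm (hpow r hr)
      rw [norm_mul, norm_mul, ← ofReal_one, ← ofReal_div, Complex.norm_cpow_eq_rpow_re_of_pos
        (by positivity), Complex.norm_cpow_eq_rpow_re_of_pos pi_pos, Complex.norm_real,
        Real.norm_of_nonneg (by positivity), ofReal_one] at this
      rw [norm_smul]
      simp only [neg_re] at this
      linear_combination (-Real.Gamma w.re * ‖h r‖) * this
  unfold mellin
  simp only [smul_eq_mul (α := ℂ)]
  simp_rw [← integral_const_mul]
  rw [integral_integral_swap hint]
  refine setIntegral_congr_fun measurableSet_Ioi fun r hr => ?_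
  have hr : 0 < r := hr
  have e1 : ∀ t : ℝ, (t : ℂ) ^ (w - 1) *
      ((r ^ (d - 1) : ℝ) • (h r * cexp (-((π * r ^ 2 : ℝ) * (t : ℂ)))))
      = (((r ^ (d - 1) : ℝ) : ℂ) * h r) *
        ((t : ℂ) ^ (w - 1) * cexp (-((π * r ^ 2 : ℝ) * (t : ℂ)))) := by
    intro t; rw [Complex.real_smul]; ring
  simp only [e1]
  rw [integral_const_mul, Complex.integral_cpow_mul_exp_neg_mul_Ioi hw (by positivity)]
  linear_combination (Complex.Gamma w * h r) * hpow r hr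

open Set Filter Topology in
lemma mfr_profile (d : ℕ) (hd : 0 < d)
    (f : SchwartzMap (EuclideanSpace ℝ (Fin d)) ℂ) (f₀ : ℝ → ℂ)
    (hf : ∀ x : EuclideanSpace ℝ (Fin d), f x = f₀ ‖x‖) :
    ContinuousOn f₀ (Ioi 0) ∧ ∀ s : ℂ, 0 < s.re → MellinConvergent f₀ s := by
  let e : EuclideanSpace ℝ (Fin d) := EuclideanSpace.single ⟨0, hd⟩ 1
  have he : ‖e‖ = 1 := by simp [e]
  have h0 : ∀ r : ℝ, 0 ≤ r → f₀ r = f (r • e) := by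
    intro r hr
    rw [hf, norm_smul, he, mul_one, Real.norm_of_nonneg hr]
  have hc : ContinuousOn f₀ (Ioi 0) := by
    have : Continuous fun r : ℝ => f (r • e) := f.continuous.comp (by fun_prop)
    exact this.continuousOn.congr fun r hr => h0 r (le_of_lt hr)
  refine ⟨hc, fun s hs => ?_⟩
  refine mellinConvergent_of_isBigO_rpow (a := s.re + 1) (b := 0)
    (hc.locallyIntegrableOn measurableSet_Ioi) ?_ (by linarith) ?_ hs
  · have ht : Tendsto (fun r : ℝ => r • e) atTop (cocompact _) := by
      rw [← Metric.cobounded_eq_cocompact, ← tendsto_norm_atTop_iff_cobounded]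
      simp only [norm_smul, he, mul_one]
      exact tendsto_norm_atTop_atTop
    have := (f.isBigO_cocompact_rpow (-(s.re + 1))).comp_tendsto ht
    refine this.congr' ?_ ?_
    · filter_upwards [eventually_ge_atTop 0] with r hr
      exact (h0 r hr).symm
    · filter_upwards [eventually_ge_atTop 0] with r hr
      simp [norm_smul, he, abs_of_nonneg hr]
  · obtain ⟨C, -, hC⟩ := f.decay 0 0
    simp only [pow_zero, one_mul, norm_iteratedFDeriv_zero] at hC
    refine Asymptotics.IsBigO.of_bound C ?_
    filter_upwards [self_mem_nhdsWithin] with r hr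
    simpa [h0 r (le_of_lt hr)] using hC (r • e)

open Set Filter Topology in
lemma mfr_gauss (d : ℕ) (hd : 0 < d)
    (f : SchwartzMap (EuclideanSpace ℝ (Fin d)) ℂ) (f₀ g₀ : ℝ → ℂ)
    (hf : ∀ x : EuclideanSpace ℝ (Fin d), f x = f₀ ‖x‖)
    (hg : ∀ y : EuclideanSpace ℝ (Fin d), (𝓕 ⇑f) y = g₀ ‖y‖) (t : ℝ) (ht : 0 < t) :
    (∫ r in Ioi (0 : ℝ), (r ^ (d - 1) : ℝ) • (g₀ r * cexp (-((π * r ^ 2 : ℝ) * (t : ℂ)))))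
    = (t : ℂ) ^ (-(d : ℂ) / 2) * ∫ r in Ioi (0 : ℝ), (r ^ (d - 1) : ℝ) •
        (f₀ r * cexp (-((π * r ^ 2 : ℝ) * ((t⁻¹ : ℝ) : ℂ)))) := by
  have : Nonempty (Fin d) := ⟨⟨0, hd⟩⟩
  have hb : 0 < ((π * t : ℝ) : ℂ).re := by rw [ofReal_re]; positivity
  have htc : (t : ℂ) ≠ 0 := ofReal_ne_zero.2 ht.ne'
  have hpc : (π : ℂ) ≠ 0 := ofReal_ne_zero.2 pi_ne_zero
  have hgint : Integrable (fun v : EuclideanSpace ℝ (Fin d) => cexp (-((π * t : ℝ) : ℂ) * ‖v‖ ^ 2)) := by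
    simpa using GaussianFourier.integrable_cexp_neg_mul_sq_norm_add hb 0 (0 : EuclideanSpace ℝ (Fin d))
  have key := VectorFourier.integral_fourierIntegral_smul_eq_flip (μ := volume) (ν := volume)
    (L := innerₗ (EuclideanSpace ℝ (Fin d))) Real.continuous_fourierChar
    (by exact continuous_inner) f.integrable hgint
  rw [flip_innerₗ] at key
  change ∫ ξ, (𝓕 ⇑f) ξ • _ = ∫ x, f x • (𝓕 (fun v : EuclideanSpace ℝ (Fin d) => cexp (-((π * t : ℝ) : ℂ) * ‖v‖ ^ 2))) x at key
  simp only [fourier_gaussian_innerProductSpace hb, hf, hg, finrank_euclideanSpace,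
    Fintype.card_fin] at key
  rw [integral_fun_norm_addHaar volume
      (fun r : ℝ => g₀ r • cexp (-((π * t : ℝ) : ℂ) * (r : ℂ) ^ 2)),
    integral_fun_norm_addHaar volume
      (fun r : ℝ => f₀ r • ((π / ((π * t : ℝ) : ℂ)) ^ ((d : ℂ) / 2) *
        cexp (-(π : ℂ) ^ 2 * (r : ℂ) ^ 2 / ((π * t : ℝ) : ℂ))))] at key
  have hvol : (volume : Measure (EuclideanSpace ℝ (Fin d))).real (Metric.ball 0 1) ≠ 0 :=
    (ENNReal.toReal_pos (Metric.measure_ball_pos volume _ one_pos).ne'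
      measure_ball_lt_top.ne).ne'
  rw [finrank_euclideanSpace, Fintype.card_fin] at key
  have key2 := smul_right_injective ℂ hvol (smul_right_injective ℂ hd.ne' key)
  rw [← integral_const_mul]
  convert key2 using 1
  · refine setIntegral_congr_fun measurableSet_Ioi fun r hr => ?_
    simp only [smul_eq_mul (α := ℂ)]
    congr 3
    push_cast; ring
  · refine setIntegral_congr_fun measurableSet_Ioi fun r hr => ?_
    simp only [smul_eq_mul (α := ℂ), Complex.real_smul]
    have e1 : (π : ℂ) / ((π * t : ℝ) : ℂ) = (t : ℂ)⁻¹ := by push_cast; field_simp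
    have e2 : -(π : ℂ) ^ 2 * (r : ℂ) ^ 2 / ((π * t : ℝ) : ℂ)
      = (-((π * r ^ 2 : ℝ) * ((t⁻¹ : ℝ) : ℂ))) := by push_cast; field_simp
    rw [e1, e2, Complex.inv_cpow, ← Complex.cpow_neg, neg_div]
    · ring
    · rw [Complex.arg_ofReal_of_nonneg ht.le]; exact pi_pos.ne

/-- **Mellin transform functional equation for radial Fourier transforms.**
If `f` is a radial Schwartz function on `ℝ^d` with radial profile `f₀` and the
Fourier transform `𝓕f` has radial profile `g₀`, then for `0 < Re(s) < d`,
`M(g₀)(s) = π^{d/2-s} Γ(s/2)/Γ((d-s)/2) · M(f₀)(d-s)`,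
where `M(h)(s) = ∫₀^∞ h(x) x^{s-1} dx` is the Mellin transform. -/
theorem mellin_fourier_radial
    (d : ℕ) (hd : 0 < d)
    (f : SchwartzMap (EuclideanSpace ℝ (Fin d)) ℂ) (f₀ g₀ : ℝ → ℂ)
    (hf : ∀ x : EuclideanSpace ℝ (Fin d), f x = f₀ ‖x‖)
    (hg : ∀ y : EuclideanSpace ℝ (Fin d), (𝓕 ⇑f) y = g₀ ‖y‖)
    (s : ℂ) (hs0 : 0 < s.re) (hsd : s.re < d) :
    mellin g₀ s =
      (π : ℂ) ^ ((d : ℂ) / 2 - s) * (Complex.Gamma (s / 2) / Complex.Gamma (((d : ℂ) - s) / 2))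
        * mellin f₀ ((d : ℂ) - s) := by
  obtain ⟨hfc, hfm⟩ := mfr_profile d hd f f₀ hf
  obtain ⟨hgc, hgm⟩ := mfr_profile d hd (𝓕 f) g₀ (fun y => by rw [SchwartzMap.fourier_coe, hg])
  have hds : 0 < ((d : ℂ) - s).re := by simpa using hsd
  have hw1 : 0 < (((d : ℂ) - s) / 2).re := by
    rw [show (((d : ℂ) - s) / 2) = ((d : ℂ) - s) / (2 : ℝ) by norm_num, Complex.div_ofReal_re]
    positivity
  have hw2 : 0 < (s / 2).re := by
    rw [show (s / 2) = s / (2 : ℝ) by norm_num, Complex.div_ofReal_re]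
    positivity
  have i1 : (d : ℂ) - 2 * (((d : ℂ) - s) / 2) = s := by ring
  have i2 : (d : ℂ) - 2 * (s / 2) = d - s := by ring
  have A := mfr_fubini d hd g₀ hgc (((d : ℂ) - s) / 2) hw1 (by rw [i1]; exact hgm s hs0)
  have B := mfr_fubini d hd f₀ hfc (s / 2) hw2 (by rw [i2]; exact hfm _ hds)
  rw [i1] at A
  rw [i2] at B
  rw [show s / 2 = -(((d : ℂ) - s) / 2 + -(d : ℂ) / 2) by ring, ← mellin_comp_inv,
    ← mellin_cpow_smul] at B
  rw [show -(((d : ℂ) - s) / 2 + -(d : ℂ) / 2) = s / 2 by ring] at B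
  have C : ∀ u : ℂ, mellin (fun t : ℝ => ∫ r in Set.Ioi (0 : ℝ), (r ^ (d - 1) : ℝ) •
        (g₀ r * cexp (-((π * r ^ 2 : ℝ) * (t : ℂ))))) u = mellin (fun t : ℝ =>
      (t : ℂ) ^ (-(d : ℂ) / 2) • ∫ r in Set.Ioi (0 : ℝ), (r ^ (d - 1) : ℝ) •
        (f₀ r * cexp (-((π * r ^ 2 : ℝ) * ((t⁻¹ : ℝ) : ℂ))))) u := by
    intro u
    refine setIntegral_congr_fun measurableSet_Ioi fun t ht => ?_
    simp only [mfr_gauss d hd f f₀ g₀ hf hg t ht, smul_eq_mul (α := ℂ)]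
  rw [C, B] at A
  have hG := Complex.Gamma_ne_zero_of_re_pos hw1
  have hpc : (π : ℂ) ≠ 0 := ofReal_ne_zero.2 pi_ne_zero
  have e : (π : ℂ) ^ ((d : ℂ) / 2 - s) * (π : ℂ) ^ (-(((d : ℂ) - s) / 2)) = (π : ℂ) ^ (-(s / 2)) := by
    rw [← Complex.cpow_add _ _ hpc]; congr 1; ring
  have hp : (π : ℂ) ^ (-(((d : ℂ) - s) / 2)) ≠ 0 := by simp [Complex.cpow_eq_zero_iff, hpc]
  rw [← e] at A
  clear e B C
  revert A hG hp
  generalize Complex.Gamma (((d : ℂ) - s) / 2) = G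
  generalize (π : ℂ) ^ (-(((d : ℂ) - s) / 2)) = P
  generalize (π : ℂ) ^ ((d : ℂ) / 2 - s) = Q
  intro A hG hp
  field_simp
  apply mul_left_cancel₀ hp
  linear_combination -A
end

section
/- The linear programming bound for center density in ℝ¹⁶ is at least 3⁸/2¹⁶: every radial Schwartz function f : ℝ¹⁶ → ℝ with f̂ ≥ 0 everywhere, f̂(0) > 0, and f(x) ≤ 0 for |x| ≥ √3 satisfies f(0)/f̂(0)·(√3/2)¹⁶ ≥ 3⁸/2¹⁶, i.e., f(0) ≥ f̂(0). -/
open MeasureTheory FourierTransform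

namespace LP16


/-- Integer vectors as points of Euclidean space, shifted by `x`. -/
noncomputable def pt {d : ℕ} (x : Fin d → ℝ) (n : Fin d → ℤ) : EuclideanSpace ℝ (Fin d) :=
  WithLp.toLp 2 (fun i => x i + n i)

lemma summable_pi_prod (a : ℤ → ℝ) (ha : Summable a) (h0 : ∀ n, 0 ≤ a n) (d : ℕ) :
    Summable (fun n : Fin d → ℤ => ∏ i, a (n i)) := by
  induction d with
  | zero => exact Summable.of_finite
  | succ d ih =>
    rw [← (Fin.consEquiv (fun _ : Fin (d+1) => ℤ)).summable_iff]
    have := ha.mul_of_nonneg ih h0 (fun n => Finset.prod_nonneg fun i _ => h0 _)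
    refine this.congr fun p => ?_
    simp [Fin.prod_univ_succ, Fin.consEquiv]

lemma summable_base : Summable (fun n : ℤ => 1 / (1 + (n : ℝ) ^ 2)) := by
  have h : Summable (fun n : ℤ => 1 / (n : ℝ) ^ 2) := Real.summable_one_div_int_pow.mpr one_lt_two
  have h1 : Summable (fun n : ℤ => 1 / (n : ℝ) ^ 2 + if n = 0 then 1 else 0) :=
    h.add (summable_of_hasFiniteSupport ((Set.finite_singleton (0:ℤ)).subset (by
      intro n hn; by_contra h; simp at h; simp [h] at hn)))
  refine Summable.of_nonneg_of_le (fun n => by positivity) (fun n => ?_) h1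
  by_cases hn : n = 0
  · simp [hn]
  · have : (0:ℝ) < (n:ℝ)^2 := by positivity
    simp only [hn, if_false, add_zero]
    exact one_div_le_one_div_of_le this (by linarith)

lemma decay {d : ℕ} (h : SchwartzMap (EuclideanSpace ℝ (Fin d)) ℂ) :
    ∃ C : ℝ, 0 ≤ C ∧ ∀ y : EuclideanSpace ℝ (Fin d), ‖h y‖ * ∏ i, (1 + (y i) ^ 2) ≤ C := by
  have key := fun y => SchwartzMap.one_add_le_sup_seminorm_apply (𝕜 := ℝ) (m := (2 * d, 0)) (k := 2 * d) (n := 0)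
    le_rfl le_rfl h y
  set C := (2:ℝ) ^ (2 * d) * ((Finset.Iic (2 * d, 0)).sup fun m => SchwartzMap.seminorm ℝ m.1 m.2) h
  refine ⟨C, le_trans (by positivity) (key 0), fun y => le_trans ?_ (key y)⟩
  rw [norm_iteratedFDeriv_zero, mul_comm]
  gcongr
  calc ∏ i, (1 + (y i) ^ 2) ≤ ∏ i : Fin d, (1 + ‖y‖) ^ 2 := by
        apply Finset.prod_le_prod
        · intros; positivity
        · intro i _
          have := PiLp.norm_apply_le y i
          have h2 : (y i)^2 ≤ ‖y‖^2 := by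
            rw [← sq_abs]; exact pow_le_pow_left₀ (abs_nonneg _) this 2
          nlinarith [norm_nonneg y]
    _ = (1 + ‖y‖) ^ (2 * d) := by simp [pow_mul]

lemma bound {d : ℕ} (h : SchwartzMap (EuclideanSpace ℝ (Fin d)) ℂ) (R : ℝ) :
    ∃ b : (Fin d → ℤ) → ℝ, Summable b ∧
      ∀ x : Fin d → ℝ, (∀ i, |x i| ≤ R) → ∀ n, ‖h (pt x n)‖ ≤ b n := by
  obtain ⟨C, hC0, hC⟩ := decay h
  refine ⟨fun n => (C * (2 + 2 * R^2)^d) * ∏ i, (1 / (1 + (n i : ℝ)^2)),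
    (summable_pi_prod _ summable_base (fun n => by positivity) d).mul_left _, ?_⟩
  intro x hx n
  have h1 : ∏ i, (1 + (n i : ℝ)^2) ≤ (2 + 2 * R^2)^d * ∏ i, (1 + (pt x n i)^2) := by
    have : (2 + 2 * R^2)^d = ∏ i : Fin d, (2 + 2 * R^2) := by simp
    rw [this, ← Finset.prod_mul_distrib]
    apply Finset.prod_le_prod
    · intros; positivity
    · intro i _
      have h3 : (x i)^2 ≤ R^2 := sq_le_sq' (by linarith [(abs_le.mp (hx i)).1]) (abs_le.mp (hx i)).2
      simp only [pt]
      nlinarith [sq_nonneg (2 * x i + n i), sq_nonneg (x i + n i), sq_nonneg R, mul_nonneg (sq_nonneg R) (sq_nonneg (x i + n i))]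
  have hp : 0 < ∏ i, (1 + (n i : ℝ)^2) := Finset.prod_pos fun i _ => by positivity
  beta_reduce
  rw [Finset.prod_div_distrib, Finset.prod_const_one, mul_one_div, le_div_iff₀ hp]
  calc _ ≤ ‖h (pt x n)‖ * ((2 + 2 * R^2)^d * ∏ i, (1 + (pt x n i)^2)) := by gcongr
    _ = (‖h (pt x n)‖ * ∏ i, (1 + (pt x n i)^2)) * (2 + 2 * R^2)^d := by ring
    _ ≤ _ := by gcongr; exact hC _

lemma summable_pt {d : ℕ} (h : SchwartzMap (EuclideanSpace ℝ (Fin d)) ℂ) (x : Fin d → ℝ) :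
    Summable (fun n => h (pt x n)) := by
  obtain ⟨b, hb, hx⟩ := bound h ‖x‖
  exact Summable.of_norm_bounded hb (hx x (fun i => norm_le_pi_norm x i))

lemma continuous_pt {d : ℕ} (n : Fin d → ℤ) : Continuous (fun x : Fin d → ℝ => pt x n) := by
  unfold pt
  fun_prop

lemma continuous_per {d : ℕ} (h : SchwartzMap (EuclideanSpace ℝ (Fin d)) ℂ) :
    Continuous (fun x : Fin d → ℝ => ∑' n, h (pt x n)) := by
  rw [continuous_iff_continuousAt]
  intro x
  obtain ⟨b, hb, hx⟩ := bound h (‖x‖ + 1)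
  have : ContinuousOn (fun x : Fin d → ℝ => ∑' n, h (pt x n)) (Metric.ball 0 (‖x‖+1)) := by
    refine continuousOn_tsum (fun n => (h.continuous.comp (continuous_pt n)).continuousOn) hb ?_
    intro n y hy
    refine hx y (fun i => (norm_le_pi_norm y i).trans ?_) n
    simpa using (Metric.mem_ball.mp hy).le
  exact this.continuousAt (Metric.isOpen_ball.mem_nhds (by simp))

lemma per_add {d : ℕ} (h : EuclideanSpace ℝ (Fin d) → ℂ) (x : Fin d → ℝ) (m : Fin d → ℤ) :
    ∑' n, h (pt (fun i => x i + m i) n) = ∑' n, h (pt x n) := by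
  rw [← (Equiv.addLeft m).tsum_eq (fun n => h (pt x n))]
  congr 1; ext n; congr 1; ext i; simp [pt, add_assoc]

/-- The unit box. -/
def box (d : ℕ) : Set (Fin d → ℝ) := {x | ∀ i, x i ∈ Set.Ioc ((0 : Fin d → ℝ) i) ((0 : Fin d → ℝ) i + 1)}

lemma measurable_box (d : ℕ) : MeasurableSet (box d) :=
  MeasurableSet.univ_pi' (fun i => measurableSet_Ioc)

lemma volume_box (d : ℕ) : volume (box d) = 1 := by
  have : box d = Set.univ.pi (fun _ => Set.Ioc (0:ℝ) 1) := by ext; simp [box]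
  rw [this, volume_pi_pi]; simp

lemma hasSum_box {d : ℕ} (g : (Fin d → ℝ) → ℂ) (hg : Integrable g) :
    HasSum (fun n : Fin d → ℤ => ∫ x in box d, g (fun i => x i + n i)) (∫ x, g x) := by
  let B : (Fin d → ℤ) → Set (Fin d → ℝ) := fun n => (fun x i => x i - n i) ⁻¹' box d
  have hm : ∀ n, MeasurableSet (B n) := fun n => (measurable_box d).preimage (by fun_prop)
  have hmem : ∀ n x, x ∈ B n ↔ ∀ i, n i = ⌈x i⌉ - 1 := by
    intro n x
    simp only [B, box, Set.mem_preimage, Set.mem_ofPred_eq]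
    refine forall_congr' fun i => ?_
    rw [eq_comm, sub_eq_iff_eq_add, Int.ceil_eq_iff]
    simp only [Set.mem_Ioc, Pi.zero_apply, zero_add]
    push_cast
    constructor <;> rintro ⟨a, b⟩ <;> constructor <;> linarith
  have hd : Pairwise (Function.onFun Disjoint B) := by
    intro m n hmn
    rw [Function.onFun, Set.disjoint_left]
    intro x h1 h2
    apply hmn
    ext i
    rw [(hmem _ _).1 h1 i, (hmem _ _).1 h2 i]
  have hU : ⋃ n, B n = Set.univ := by
    ext x; simp only [Set.mem_iUnion, Set.mem_univ, iff_true]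
    exact ⟨fun i => ⌈x i⌉ - 1, (hmem _ _).2 fun i => rfl⟩
  have := hasSum_integral_iUnion (f := g) hm hd (by rw [hU]; exact hg.integrableOn)
  rw [hU, setIntegral_univ] at this
  have e : ∀ n : Fin d → ℤ, ∫ x in B n, g x = ∫ x in box d, g (fun i => x i + n i) := ?_
  · simpa only [e] using this
  intro n
  have mp : MeasurePreserving (fun x : Fin d → ℝ => x + fun i => (n i : ℝ)) volume volume :=
    measurePreserving_add_right volume _
  rw [← mp.setIntegral_preimage_emb (MeasurableEquiv.addRight _).measurableEmbedding]
  congr 2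
  simp [B, Set.preimage, box]

lemma integrable_pi {d : ℕ} (h : SchwartzMap (EuclideanSpace ℝ (Fin d)) ℂ) :
    Integrable (fun x : Fin d → ℝ => h (WithLp.toLp 2 x)) :=
  (PiLp.volume_preserving_toLp (Fin d)).integrable_comp_emb
    (MeasurableEquiv.toLp 2 (Fin d → ℝ)).measurableEmbedding |>.2 h.integrable

lemma mF_coe {d : ℕ} (n : Fin d → ℤ) (x : Fin d → ℝ) :
    UnitAddTorus.mFourier n (fun i => (x i : UnitAddCircle)) =
      Complex.exp (2 * Real.pi * Complex.I * ∑ i, (n i : ℂ) * x i) := by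
  simp only [UnitAddTorus.mFourier, ContinuousMap.coe_mk, fourier_coe_apply, ← Complex.exp_sum]
  congr 1
  rw [Finset.mul_sum]
  refine Finset.sum_congr rfl fun i _ => ?_
  push_cast; ring

lemma mF_norm {d : ℕ} (n : Fin d → ℤ) (x : UnitAddTorus (Fin d)) :
    ‖UnitAddTorus.mFourier n x‖ = 1 := by
  simp only [UnitAddTorus.mFourier, ContinuousMap.coe_mk, fourier_apply, norm_prod, Circle.norm_coe,
    Finset.prod_const_one]

lemma fourier_pi {d : ℕ} (h : SchwartzMap (EuclideanSpace ℝ (Fin d)) ℂ) (m : Fin d → ℤ) :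
    (𝓕 ⇑h) (pt 0 m) =
      ∫ x : Fin d → ℝ, UnitAddTorus.mFourier (-m) (fun i => (x i : UnitAddCircle)) * h (WithLp.toLp 2 x) := by
  rw [Real.fourier_eq', ← (PiLp.volume_preserving_toLp (Fin d)).integral_comp
    (MeasurableEquiv.toLp 2 (Fin d → ℝ)).measurableEmbedding]
  congr 1; ext x
  rw [mF_coe, smul_eq_mul]
  congr 2
  simp [pt, PiLp.inner_apply, mul_comm]
  ring

lemma coeff_eq {d : ℕ} (h : SchwartzMap (EuclideanSpace ℝ (Fin d)) ℂ) (m : Fin d → ℤ) :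
    ∫ x in box d, UnitAddTorus.mFourier (-m) (fun i => (x i : UnitAddCircle)) * ∑' n, h (pt x n)
      = (𝓕 ⇑h) (pt 0 m) := by
  let e : (Fin d → ℝ) → ℂ := fun x => UnitAddTorus.mFourier (-m) (fun i => (x i : UnitAddCircle))
  have hec : Continuous e := by
    refine (UnitAddTorus.mFourier (-m)).continuous.comp ?_
    exact continuous_pi fun i => (AddCircle.continuous_mk' 1).comp (continuous_apply i)
  have hen : ∀ x, ‖e x‖ = 1 := fun x => mF_norm _ _
  have hper : ∀ x (n : Fin d → ℤ), e (fun i => x i + n i) = e x := by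
    intro x n
    simp only [e]
    congr 1; ext i
    have := (AddCircle.coe_add_period (1:ℝ) )
    rw [AddCircle.coe_add]
    have h0 : ((n i : ℝ) : UnitAddCircle) = 0 := by
      rw [AddCircle.coe_eq_zero_iff]; exact ⟨n i, by simp⟩
    rw [h0, add_zero]
  have hint : Integrable (fun x : Fin d → ℝ => e x * h (WithLp.toLp 2 x)) :=
    (integrable_pi h).bdd_mul (c := 1) hec.aestronglyMeasurable (Filter.Eventually.of_forall fun x => (hen x).le)
  have h1 := hasSum_box _ hint
  rw [fourier_pi]
  refine Eq.trans ?_ h1.tsum_eq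
  have h2 : ∀ n : Fin d → ℤ, ∀ x : Fin d → ℝ, e (fun i => x i + n i) * h (WithLp.toLp 2 (fun i => x i + n i))
      = e x * h (pt x n) := fun n x => by rw [hper]; rfl
  simp only [h2]
  obtain ⟨b, hb, hx⟩ := bound h 1
  have hle : ∀ n, ∀ x ∈ box d, ‖e x * h (pt x n)‖ ≤ b n := by
    intro n x hxb
    rw [norm_mul, hen, one_mul]
    refine hx x (fun i => ?_) n
    have := hxb i
    simp at this
    rw [abs_le]; constructor <;> linarith
  have hci : ∀ n, Integrable (fun x => e x * h (pt x n)) (volume.restrict (box d)) := by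
    intro n
    refine Measure.integrableOn_of_bounded (M := b n) (by rw [volume_box]; simp)
      (hec.mul (h.continuous.comp (continuous_pt n))).aestronglyMeasurable ?_
    exact (ae_restrict_iff' (measurable_box d)).2 (Filter.Eventually.of_forall (hle n))
  have hs := hasSum_integral_of_summable_integral_norm hci (by
    refine Summable.of_nonneg_of_le (fun n => integral_nonneg fun x => norm_nonneg _) (fun n => ?_) hb
    calc _ ≤ ∫ x in box d, b n := by
          refine setIntegral_mono_on (hci n).norm ?_ (measurable_box d) (hle n)
          exact integrableOn_const (by rw [volume_box]; simp)
      _ = b n := by simp [Measure.real, volume_box])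
  rw [hs.tsum_eq]
  congr 1; ext x
  rw [tsum_mul_left]

/-- Poisson summation in several variables for Schwartz functions. -/
lemma poisson {d : ℕ} (h : SchwartzMap (EuclideanSpace ℝ (Fin d)) ℂ) (x : Fin d → ℝ) :
    ∑' n, h (pt x n) =
      ∑' m, (𝓕 ⇑h) (pt 0 m) * Complex.exp (2 * Real.pi * Complex.I * ∑ i, (m i : ℂ) * x i) := by
  let H : (Fin d → ℝ) → ℂ := fun x => ∑' n, h (pt x n)
  let π : (Fin d → ℝ) → UnitAddTorus (Fin d) := fun x i => (x i : UnitAddCircle)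
  have hq : IsOpenQuotientMap π := IsOpenQuotientMap.piMap fun i =>
    (QuotientAddGroup.isOpenQuotientMap_mk (N := AddSubgroup.zmultiples (1:ℝ)))
  let s : UnitAddTorus (Fin d) → (Fin d → ℝ) := Function.surjInv hq.surjective
  have hs : ∀ t, π (s t) = t := Function.surjInv_eq hq.surjective
  have hH : ∀ x, H (s (π x)) = H x := by
    intro x
    have h1 : ∀ i, ∃ k : ℤ, s (π x) i = x i + k := by
      intro i
      have h2 : ((s (π x) i - x i : ℝ) : UnitAddCircle) = 0 := by
        rw [AddCircle.coe_sub, sub_eq_zero]; exact congrFun (hs (π x)) i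
      rw [AddCircle.coe_eq_zero_iff] at h2
      obtain ⟨k, hk⟩ := h2
      refine ⟨k, ?_⟩
      simp at hk; linarith
    choose k hk using h1
    have : s (π x) = fun i => x i + k i := funext hk
    rw [this]; exact per_add _ x k
  let F : C(UnitAddTorus (Fin d), ℂ) := ⟨fun t => H (s t), by
    rw [hq.isQuotientMap.continuous_iff]
    have : (fun t => H (s t)) ∘ π = H := funext hH
    rw [this]; exact continuous_per h⟩
  have hF : ∀ x, F (π x) = H x := hH
  have hco : ∀ m, UnitAddTorus.mFourierCoeff F m = (𝓕 ⇑h) (pt 0 m) := by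
    intro m
    rw [UnitAddTorus.mFourierCoeff_eq_integral F m 0, ← coeff_eq]
    refine setIntegral_congr_fun (measurable_box d) fun x _ => ?_
    simp only [smul_eq_mul]
    congr 1
    exact hF x
  have hsum : Summable (UnitAddTorus.mFourierCoeff F) := by
    rw [show UnitAddTorus.mFourierCoeff F = fun m => (𝓕 ⇑h) (pt 0 m) from funext hco]
    exact summable_pt (𝓕 h) 0
  have := (UnitAddTorus.hasSum_mFourier_series_apply_of_summable hsum (π x)).tsum_eq
  rw [hF] at this
  refine Eq.trans this.symm ?_
  congr 1; ext m
  rw [hco, smul_eq_mul, mF_coe]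


/-- The sublattice sign character. -/
noncomputable def chi {ι : Type*} (T : Finset ι) (u : ι → ℤ) : ℝ := ∏ i ∈ T, (-1 : ℝ) ^ (u i)

lemma chi_abs {ι : Type*} (T : Finset ι) (u : ι → ℤ) : |chi T u| = 1 := by
  unfold chi
  rw [Finset.abs_prod]
  exact Finset.prod_eq_one fun i _ => by rw [abs_zpow]; simp

/-- Sign of a block. -/
noncomputable def bs (v : Fin 4 → ℤ) : ℝ := ∏ k, (-1 : ℝ) ^ (v k)

lemma bs_eq (v : Fin 4 → ℤ) : bs v = (-1 : ℝ) ^ (∑ k, v k) := by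
  simp only [bs, Fin.prod_univ_four, Fin.sum_univ_four]
  have : (-1:ℝ) ≠ 0 := by norm_num
  rw [zpow_add₀ this, zpow_add₀ this, zpow_add₀ this]

/-- The Hadamard involution exchanging even and odd vectors. -/
def psi (v : Fin 4 → ℤ) : Fin 4 → ℤ :=
  let S := (v 0 + v 1 + v 2 + v 3) / 2
  if (v 0 + v 1 + v 2 + v 3) % 2 = 0 then
    ![S + 1, S - v 2 - v 3, S - v 1 - v 3, S - v 1 - v 2]
  else ![S, S - v 2 - v 3, S - v 1 - v 3, S - v 1 - v 2]

lemma psi_pos (v : Fin 4 → ℤ) (S : ℤ) (h : v 0 + v 1 + v 2 + v 3 = 2 * S) :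
    psi v = ![S + 1, S - v 2 - v 3, S - v 1 - v 3, S - v 1 - v 2] := by
  have h2 : (v 0 + v 1 + v 2 + v 3) / 2 = S := by omega
  have h1 : (v 0 + v 1 + v 2 + v 3) % 2 = 0 := by omega
  simp only [psi, h1, h2, if_true]

lemma psi_neg (v : Fin 4 → ℤ) (S : ℤ) (h : v 0 + v 1 + v 2 + v 3 = 2 * S + 1) :
    psi v = ![S, S - v 2 - v 3, S - v 1 - v 3, S - v 1 - v 2] := by
  have h2 : (v 0 + v 1 + v 2 + v 3) / 2 = S := by omega
  have h1 : ¬ (v 0 + v 1 + v 2 + v 3) % 2 = 0 := by omega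
  simp only [psi, h1, h2, if_false]

lemma psi_invol : Function.Involutive psi := by
  intro v
  obtain ⟨S, hS | hS⟩ := Int.even_or_odd' (v 0 + v 1 + v 2 + v 3)
  · rw [psi_pos v S hS, psi_neg _ (v 0) (by simp; omega)]
    ext i
    fin_cases i <;> simp <;> omega
  · rw [psi_neg v S hS, psi_pos _ (v 0 - 1) (by simp; omega)]
    ext i
    fin_cases i <;> simp <;> omega

/-- even coordinate sum -/
def ev (v : Fin 4 → ℤ) : Prop := (v 0 + v 1 + v 2 + v 3) % 2 = 0

instance (v : Fin 4 → ℤ) : Decidable (ev v) := by unfold ev; infer_instance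

lemma psi_ev (v : Fin 4 → ℤ) : ev (psi v) ↔ ¬ ev v := by
  unfold ev
  obtain ⟨S, hS | hS⟩ := Int.even_or_odd' (v 0 + v 1 + v 2 + v 3)
  · rw [psi_pos v S hS]; simp; omega
  · rw [psi_neg v S hS]; simp; omega

lemma psi_norm (v : Fin 4 → ℤ) (h : ev v) :
    ∑ k, ((psi v k : ℝ)) ^ 2 = ∑ k, ((v k : ℝ) + 1 / 2) ^ 2 := by
  unfold ev at h
  obtain ⟨S, hS⟩ := Int.dvd_of_emod_eq_zero h
  rw [psi_pos v S hS]
  have h0 : v 0 = 2 * S - v 1 - v 2 - v 3 := by omega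
  simp only [Fin.sum_univ_four, Matrix.cons_val, h0]
  push_cast
  ring

/-- Flip of the first coordinate. -/
def flip0 (v : Fin 4 → ℤ) : Fin 4 → ℤ := ![-1 - v 0, v 1, v 2, v 3]

lemma flip0_invol : Function.Involutive flip0 := by
  intro v; ext i; fin_cases i <;> simp [flip0]

lemma flip0_ev (v : Fin 4 → ℤ) : ev (flip0 v) ↔ ¬ ev v := by
  unfold ev; simp only [flip0, Matrix.cons_val]; omega

lemma flip0_norm (v : Fin 4 → ℤ) :
    ∑ k, ((flip0 v k : ℝ) + 1 / 2) ^ 2 = ∑ k, ((v k : ℝ) + 1 / 2) ^ 2 := by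
  simp only [Fin.sum_univ_four, flip0, Matrix.cons_val]; push_cast; ring

lemma one_sub_bs (v : Fin 4 → ℤ) : 1 - bs v = if ev v then 0 else 2 := by
  rw [bs_eq, Fin.sum_univ_four]
  split_ifs with h
  · have : Even (v 0 + v 1 + v 2 + v 3) := Int.even_iff.2 h
    rw [this.neg_one_zpow]; ring
  · have : Odd (v 0 + v 1 + v 2 + v 3) := by
      rw [Int.odd_iff]; unfold ev at h; omega
    rw [this.neg_one_zpow]; ring

lemma block_step {R : Type*} (H : ℝ → R → ℝ)
    (h1 : Summable fun p : (Fin 4 → ℤ) × R => H (∑ k, ((p.1 k : ℝ) + 1 / 2) ^ 2) p.2) :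
    ∑' p : (Fin 4 → ℤ) × R, H (∑ k, ((p.1 k : ℝ) + 1 / 2) ^ 2) p.2 =
    ∑' p : (Fin 4 → ℤ) × R, (1 - bs p.1) * H (∑ k, ((p.1 k : ℝ)) ^ 2) p.2 := by
  set A : (Fin 4 → ℤ) × R → ℝ := fun p => H (∑ k, ((p.1 k : ℝ) + 1 / 2) ^ 2) p.2 with hA
  let ρ : (Fin 4 → ℤ) × R ≃ (Fin 4 → ℤ) × R := flip0_invol.toPerm.prodCongr (Equiv.refl R)
  let Ψ : (Fin 4 → ℤ) × R ≃ (Fin 4 → ℤ) × R := psi_invol.toPerm.prodCongr (Equiv.refl R)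
  let Ae : (Fin 4 → ℤ) × R → ℝ := fun p => if ev p.1 then A p else 0
  let Ao : (Fin 4 → ℤ) × R → ℝ := fun p => if ev p.1 then 0 else A p
  have se : Summable Ae := Summable.of_norm_bounded h1.norm (fun p => by
    simp only [Ae]; split_ifs <;> simp [A])
  have so : Summable Ao := Summable.of_norm_bounded h1.norm (fun p => by
    simp only [Ao]; split_ifs <;> simp [A])
  have hs : A = fun p => Ae p + Ao p := by
    ext p; simp only [Ae, Ao]; split_ifs <;> simp
  have hoe : ∑' p, Ao p = ∑' p, Ae p := by
    rw [← ρ.tsum_eq]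
    congr 1; ext p
    have : (ρ p).1 = flip0 p.1 := rfl
    have h2 : (ρ p).2 = p.2 := rfl
    simp only [Ao, Ae, hA, this, h2, flip0_ev, flip0_norm]
    split_ifs <;> simp_all
  have h3 : ∑' p, A p = 2 * ∑' p, Ae p := by
    rw [hs, se.tsum_add so, hoe]; ring
  rw [h3, ← tsum_mul_left, ← Ψ.tsum_eq (fun p => (1 - bs p.1) * H (∑ k, ((p.1 k : ℝ)) ^ 2) p.2)]
  congr 1; ext p
  have : (Ψ p).1 = psi p.1 := rfl
  have h2 : (Ψ p).2 = p.2 := rfl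
  simp only [this, h2, one_sub_bs, psi_ev, Ae]
  by_cases h : ev p.1
  · simp [h, psi_norm _ h, A]
  · simp [h]

/-- squared norm of a point with half-shifted blocks -/
noncomputable def NB (C : Finset (Fin 4)) (u : Fin 4 → Fin 4 → ℤ) : ℝ :=
  ∑ b, ∑ k, ((u b k : ℝ) + if b ∈ C then 1 / 2 else 0) ^ 2

lemma summable_weight {α : Type*} (w a : α → ℝ) (c : ℝ) (hw : ∀ x, |w x| ≤ c) (ha : Summable a) :
    Summable fun x => w x * a x := by
  refine Summable.of_norm_bounded (ha.norm.mul_left c) fun x => ?_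
  rw [norm_mul]
  exact mul_le_mul_of_nonneg_right (hw x) (norm_nonneg _)

lemma weight_bd (D : Finset (Fin 4)) (u : Fin 4 → Fin 4 → ℤ) :
    |∏ b ∈ D, (1 - bs (u b))| ≤ 2 ^ D.card := by
  rw [Finset.abs_prod]
  rw [← Finset.prod_const]
  refine Finset.prod_le_prod (fun _ _ => abs_nonneg _) fun b _ => ?_
  rw [one_sub_bs]; split_ifs <;> norm_num

lemma blocks (G : ℝ → ℝ) (hG : ∀ C, Summable fun u => G (NB C u)) (C D : Finset (Fin 4))
    (hCD : Disjoint C D) :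
    ∑' u, (∏ b ∈ D, (1 - bs (u b))) * G (NB C u) =
      ∑' u, (∏ b ∈ C ∪ D, (1 - bs (u b))) * G (NB ∅ u) := by
  induction C using Finset.induction_on generalizing D with
  | empty => simp
  | insert a C ha ih =>
    rw [Finset.disjoint_insert_left] at hCD
    have hI := ih (insert a D) (by
      rw [Finset.disjoint_insert_right]; exact ⟨ha, hCD.2⟩)
    rw [Finset.union_insert, ← Finset.insert_union] at hI
    rw [← hI]
    let e := (Equiv.funSplitAt a (Fin 4 → ℤ)).symm
    have ea : ∀ p, e p a = p.1 := fun p => by simp [e, Equiv.funSplitAt, Equiv.piSplitAt]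
    have eb : ∀ p b (hb : b ≠ a), e p b = p.2 ⟨b, hb⟩ := fun p b hb => by
      simp [e, Equiv.funSplitAt, Equiv.piSplitAt, hb]
    rw [← e.tsum_eq, ← e.tsum_eq (fun u => (∏ b ∈ insert a D, (1 - bs (u b))) * G (NB C u))]
    let rest : ({j // j ≠ a} → Fin 4 → ℤ) → ℝ := fun r =>
      ∑ b : {j // j ≠ a}, ∑ k, ((r b k : ℝ) + if b.1 ∈ C then 1 / 2 else 0) ^ 2
    let wt : ({j // j ≠ a} → Fin 4 → ℤ) → ℝ := fun r => ∏ b ∈ D, (1 - bs (e (0, r) b))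
    have hw : ∀ p, ∏ b ∈ D, (1 - bs (e p b)) = wt p.2 := by
      intro p
      refine Finset.prod_congr rfl fun b hb => ?_
      have : b ≠ a := fun h => hCD.1 (h ▸ hb)
      rw [eb _ b this, eb _ b this]
    have hn : ∀ (C' : Finset (Fin 4)) p, (∀ b, b ≠ a → (b ∈ C' ↔ b ∈ C)) → NB C' (e p) =
        ∑ k, ((p.1 k : ℝ) + if a ∈ C' then 1 / 2 else 0) ^ 2 + rest p.2 := by
      intro C' p hC'
      unfold NB
      rw [Fintype.sum_eq_add_sum_subtype_ne _ a, ea]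
      congr 1
      refine Finset.sum_congr rfl fun b _ => ?_
      simp only [eb p b.1 b.2, hC' b.1 b.2]
    have hn1 : ∀ p, NB (insert a C) (e p) = ∑ k, ((p.1 k : ℝ) + 1 / 2) ^ 2 + rest p.2 := by
      intro p; rw [hn _ p (fun b hb => by simp [hb])]; simp
    have hn2 : ∀ p, NB C (e p) = ∑ k, ((p.1 k : ℝ)) ^ 2 + rest p.2 := by
      intro p; rw [hn _ p (fun b hb => Iff.rfl)]; simp [ha]
    have := block_step (fun t r => wt r * G (t + rest r)) (by
      have h := summable_weight _ _ _ (weight_bd D) (hG (insert a C))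
      rw [← e.summable_iff] at h
      refine h.congr fun p => ?_
      simp only [Function.comp, hw, hn1])
    simp only [hw, hn1, hn2, Finset.prod_insert hCD.1, ea]
    rw [this]
    congr 1; ext p; ring


/-- Sixteen-dimensional Euclidean space. -/
abbrev E16 := EuclideanSpace ℝ (Fin 16)

/-- The profile of a radial function, as a function of the squared norm. -/
noncomputable def prof (F : E16 → ℂ) (t : ℝ) : ℝ :=
  (F (Real.sqrt t • EuclideanSpace.single (0 : Fin 16) (1 : ℝ))).re

lemma prof_eq (F : E16 → ℂ) (hF : ∀ x y : E16, ‖x‖ = ‖y‖ → F x = F y) (x : E16) :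
    (F x).re = prof F (‖x‖ ^ 2) := by
  unfold prof
  congr 1
  apply hF
  rw [norm_smul, Real.sqrt_sq (norm_nonneg _)]
  simp

lemma fourier_radial (F : E16 → ℂ) (hF : ∀ x y : E16, ‖x‖ = ‖y‖ → F x = F y) :
    ∀ x y : E16, ‖x‖ = ‖y‖ → (𝓕 F) x = (𝓕 F) y := by
  intro x y h
  have h1 := Submodule.reflection_sub h
  set A : E16 ≃ₗᵢ[ℝ] E16 := Submodule.reflection (Submodule.span ℝ {x - y})ᗮ
  have h2 : F ∘ A = F := by
    funext z
    exact hF _ _ (by simp)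
  rw [← h1, ← Real.fourier_comp_linearIsometry, h2]

lemma norm_pt (x : Fin 16 → ℝ) (n : Fin 16 → ℤ) : ‖pt x n‖ ^ 2 = ∑ i, ((n i : ℝ) + x i) ^ 2 := by
  rw [EuclideanSpace.norm_sq_eq]
  refine Finset.sum_congr rfl fun i _ => ?_
  simp only [pt, Real.norm_eq_abs, sq_abs]
  ring

/-- Half-integral shift supported on `T`. -/
noncomputable def half (T : Finset (Fin 16)) (i : Fin 16) : ℝ := if i ∈ T then 1 / 2 else 0

lemma exp_chi (T : Finset (Fin 16)) (m : Fin 16 → ℤ) :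
    Complex.exp (2 * Real.pi * Complex.I * ∑ i, (m i : ℂ) * (half T i : ℝ)) = (chi T m : ℝ) := by
  have h : 2 * Real.pi * Complex.I * ∑ i, (m i : ℂ) * (half T i : ℝ)
      = ∑ i ∈ T, (m i : ℂ) * (Real.pi * Complex.I) := by
    rw [Finset.mul_sum, ← Finset.sum_filter_add_sum_filter_not Finset.univ (· ∈ T)]
    have h2 : ∑ x with x ∉ T, 2 * Real.pi * Complex.I * ((m x : ℂ) * (half T x : ℝ)) = 0 := by
      apply Finset.sum_eq_zero
      intro i hi
      simp only [Finset.mem_filter] at hi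
      simp [half, hi.2]
    rw [h2, add_zero]
    refine Finset.sum_congr (by ext; simp) fun i hi => ?_
    simp [half, hi]
    ring
  rw [h, Complex.exp_sum]
  simp only [chi]
  push_cast
  refine Finset.prod_congr rfl fun i _ => ?_
  rw [Complex.exp_int_mul, Complex.exp_pi_mul_I]

/-- Summability of the profile over shifted lattices. -/
lemma prof_summable (h : SchwartzMap E16 ℂ) (hF : ∀ x y : E16, ‖x‖ = ‖y‖ → h x = h y)
    (x : Fin 16 → ℝ) : Summable fun n : Fin 16 → ℤ => prof h (∑ i, ((n i : ℝ) + x i) ^ 2) := by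
  have := (Complex.hasSum_re (summable_pt h x).hasSum).summable
  refine this.congr fun n => ?_
  rw [prof_eq h hF, norm_pt]

lemma poisson_prof (f : SchwartzMap E16 ℂ) (hF : ∀ x y : E16, ‖x‖ = ‖y‖ → f x = f y)
    (T : Finset (Fin 16)) :
    ∑' n : Fin 16 → ℤ, prof (𝓕 ⇑f) (∑ i, ((n i : ℝ) + half T i) ^ 2)
      = ∑' m : Fin 16 → ℤ, chi T m * prof f (∑ i, (m i : ℝ) ^ 2) := by
  have hp := poisson (𝓕 f) (half T)
  have hs := summable_pt (𝓕 f) (half T)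
  have hff : ∀ m, (𝓕 ⇑(𝓕 f : SchwartzMap E16 ℂ)) (pt 0 m) = f (pt 0 m) := by
    intro m
    have h1 : 𝓕⁻ (𝓕 f) = f := FourierTransform.fourierInv_fourier_eq f
    have h2 : 𝓕⁻ (⇑(𝓕 f : SchwartzMap E16 ℂ)) (-(pt 0 m)) = f (-(pt 0 m)) := by
      conv_rhs => rw [← h1]
      rw [SchwartzMap.fourierInv_coe]
    rw [Real.fourierInv_eq_fourier_neg, neg_neg] at h2
    rw [h2]
    exact hF _ _ (by simp)
  have hc : ⇑(𝓕 f : SchwartzMap E16 ℂ) = 𝓕 ⇑f := SchwartzMap.fourier_coe f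
  have hr := fourier_radial f hF
  have e1 := congrArg Complex.re hp
  rw [Complex.re_tsum hs] at e1
  simp only [hff, exp_chi] at e1
  have hs2 : Summable fun m : Fin 16 → ℤ => f (pt 0 m) * ((chi T m : ℝ) : ℂ) := by
    have := (summable_pt f 0).norm
    refine Summable.of_norm (this.congr fun m => ?_)
    rw [norm_mul, Complex.norm_real, Real.norm_eq_abs, chi_abs, mul_one]
  rw [Complex.re_tsum hs2] at e1
  convert e1 using 3 with n m
  · rw [hc, prof_eq _ hr, norm_pt]
  · rw [Complex.re_mul_ofReal, prof_eq _ hF, norm_pt, mul_comm]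
    simp


/-- Character sums of the profile over the integer lattice. -/
noncomputable def J (G : ℝ → ℝ) (T : Finset (Fin 16)) : ℝ :=
  ∑' u : Fin 16 → ℤ, chi T u * G (∑ i, (u i : ℝ) ^ 2)

lemma J_card (G : ℝ → ℝ) (T T' : Finset (Fin 16)) (h : T.card = T'.card) : J G T = J G T' := by
  let e := Finset.equivOfCardEq h
  let σ : Equiv.Perm (Fin 16) := Equiv.extendSubtype e
  have hσ : T.map σ.toEmbedding = T' := by
    apply Finset.eq_of_subset_of_card_le
    · intro x hx
      simp only [Finset.mem_map] at hx
      obtain ⟨y, hy, rfl⟩ := hx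
      exact Equiv.extendSubtype_mem e y hy
    · simp [h]
  unfold J
  conv_rhs => rw [← (Equiv.arrowCongr σ (Equiv.refl ℤ)).tsum_eq]
  refine tsum_congr fun u => ?_
  congr 1
  · rw [← hσ]
    simp [chi, Finset.prod_map]
  · congr 1
    conv_rhs => rw [← Equiv.sum_comp σ]
    simp

/-- Krawtchouk sum. -/
def Kr (m k : ℕ) : ℤ :=
  ∑ p ∈ Finset.HasAntidiagonal.antidiagonal m, (-1) ^ p.1 * (k.choose p.1 : ℤ) * ((16 - k).choose p.2 : ℤ)

/-- Number of odd coordinates. -/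
def odds (u : Fin 16 → ℤ) : ℕ := (Finset.univ.filter fun i => Odd (u i)).card

open Polynomial in
lemma coeff_one_sub (k n : ℕ) : ((1 - X : ℤ[X]) ^ k).coeff n = (-1) ^ n * (k.choose n : ℤ) := by
  have : (1 - X : ℤ[X]) ^ k = ((1 + X : ℤ[X]) ^ k).comp (C (-1) * X) := by
    simp [sub_eq_add_neg]
  rw [this, Polynomial.comp_C_mul_X_coeff, Polynomial.coeff_one_add_X_pow, mul_comm]

open Polynomial in
lemma sum_chi (u : Fin 16 → ℤ) (m : ℕ) :
    ∑ T ∈ Finset.powersetCard m Finset.univ, chi T u = (Kr m (odds u) : ℝ) := by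
  let ε : Fin 16 → ℤ := fun i => if Odd (u i) then -1 else 1
  have hε : ∀ i, ((-1 : ℝ) ^ (u i)) = (ε i : ℝ) := by
    intro i
    by_cases h : Odd (u i)
    · simp [ε, h, h.neg_one_zpow]
    · have h' := Int.not_odd_iff_even.mp h
      simp only [ε, h, if_false, h'.neg_one_zpow, Int.cast_one]
  have h1 : ∏ i, (1 + C (ε i) * X : ℤ[X]) = (1 - X) ^ (odds u) * (1 + X) ^ (16 - odds u) := by
    have : ∀ i, (1 + C (ε i) * X : ℤ[X]) = if Odd (u i) then 1 - X else 1 + X := by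
      intro i
      by_cases h : Odd (u i)
      · simp [ε, h, sub_eq_add_neg]
      · simp [ε, h]
    simp only [this]
    rw [Finset.prod_ite, Finset.prod_const, Finset.prod_const]
    congr 2
    have := Finset.card_filter_add_card_filter_not (s := (Finset.univ : Finset (Fin 16))) (fun i => Odd (u i))
    simp only [Finset.card_univ, Fintype.card_fin] at this
    unfold odds
    omega
  have h2 := congrArg (fun p => p.coeff m) h1
  simp only [coeff_mul, coeff_one_sub, coeff_one_add_X_pow] at h2
  rw [Finset.prod_one_add] at h2
  simp only [Finset.prod_mul_distrib, Finset.prod_const, ← map_prod, finsetSum_coeff, coeff_C_mul_X_pow] at h2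
  have h3 : ∑ T ∈ Finset.powersetCard m Finset.univ, ∏ i ∈ T, ε i = Kr m (odds u) := by
    unfold Kr
    rw [← h2, ← Finset.sum_filter]
    refine Finset.sum_congr ?_ fun _ _ => rfl
    ext T
    simp [Finset.mem_powersetCard, eq_comm]
  rw [← h3]
  push_cast
  refine Finset.sum_congr rfl fun T _ => ?_
  simp only [chi, hε]

lemma chi_summable (G : ℝ → ℝ) (hG : Summable fun u : Fin 16 → ℤ => G (∑ i, (u i : ℝ) ^ 2))
    (T : Finset (Fin 16)) :
    Summable fun u : Fin 16 → ℤ => chi T u * G (∑ i, (u i : ℝ) ^ 2) :=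
  summable_weight _ _ 1 (fun u => (chi_abs T u).le) hG

lemma J_avg (G : ℝ → ℝ) (hG : Summable fun u : Fin 16 → ℤ => G (∑ i, (u i : ℝ) ^ 2))
    (T : Finset (Fin 16)) :
    HasSum (fun u : Fin 16 → ℤ => (Kr T.card (odds u) : ℝ) * G (∑ i, (u i : ℝ) ^ 2))
      ((Nat.choose 16 T.card : ℝ) * J G T) := by
  have h := hasSum_sum (s := Finset.powersetCard T.card Finset.univ)
    (f := fun (S : Finset (Fin 16)) (u : Fin 16 → ℤ) => chi S u * G (∑ i, (u i : ℝ) ^ 2))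
    (a := fun S => J G S) fun S _ => (chi_summable G hG S).hasSum
  convert h using 1
  · funext u
    rw [← sum_chi, Finset.sum_mul]
  · rw [Finset.sum_congr rfl (g := fun _ => J G T)]
    · simp
    · intro S hS
      exact J_card G _ _ (Finset.mem_powersetCard.mp hS).2

/-- Integral multiple of the weight. -/
def WZ (k : ℕ) : ℤ := 80080 * Kr 0 k - 88 * Kr 4 k + 7 * Kr 8 k + 77 * Kr 12 k - 70070 * Kr 16 k

set_option maxRecDepth 100000 in
lemma WZ_vals : (∀ k < 17, 0 ≤ WZ k) ∧ WZ 0 = 80080 ∧ WZ 1 = 0 ∧ WZ 2 = 0 := by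
  decide +kernel


/-- Sixteen coordinates as four blocks of four. -/
def e4 : Fin 4 × Fin 4 ≃ Fin 16 := finProdFinEquiv

/-- Integer vectors as four blocks. -/
def Phi : (Fin 16 → ℤ) ≃ (Fin 4 → Fin 4 → ℤ) :=
  (Equiv.arrowCongr e4.symm (Equiv.refl ℤ)).trans (Equiv.curry (Fin 4) (Fin 4) ℤ)

lemma Phi_apply (u : Fin 16 → ℤ) (b k : Fin 4) : Phi u b k = u (e4 (b, k)) := rfl

/-- Coordinates belonging to a set of blocks. -/
def TB (C : Finset (Fin 4)) : Finset (Fin 16) := (C ×ˢ Finset.univ).map e4.toEmbedding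

lemma TB_card (C : Finset (Fin 4)) : (TB C).card = 4 * C.card := by
  simp [TB, Finset.card_product, mul_comm]

lemma mem_TB (C : Finset (Fin 4)) (b k : Fin 4) : e4 (b, k) ∈ TB C ↔ b ∈ C := by
  simp [TB]

lemma NB_Phi (C : Finset (Fin 4)) (u : Fin 16 → ℤ) :
    NB C (Phi u) = ∑ i, ((u i : ℝ) + half (TB C) i) ^ 2 := by
  rw [← Equiv.sum_comp e4, Fintype.sum_prod_type]
  simp only [NB, Phi_apply, half, mem_TB]

lemma NB_Phi_empty (u : Fin 16 → ℤ) : NB ∅ (Phi u) = ∑ i, (u i : ℝ) ^ 2 := by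
  rw [← Equiv.sum_comp e4, Fintype.sum_prod_type]
  simp [NB, Phi_apply]

lemma chi_TB (C : Finset (Fin 4)) (u : Fin 16 → ℤ) : chi (TB C) u = ∏ b ∈ C, bs (Phi u b) := by
  simp only [chi, TB, Finset.prod_map, Finset.prod_product, bs, Phi_apply]
  rfl

/-- The first `j` blocks. -/
def Cj (j : ℕ) : Finset (Fin 4) := Finset.univ.filter fun b => b.val < j

lemma Cj_card (j : ℕ) (hj : j ≤ 4) : (Cj j).card = j := by
  interval_cases j <;> decide

lemma dual_side (H : ℝ → ℝ)
    (hH : ∀ C, Summable fun u : Fin 16 → ℤ => H (∑ i, ((u i : ℝ) + half (TB C) i) ^ 2))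
    (C : Finset (Fin 4)) :
    ∑' u : Fin 16 → ℤ, H (∑ i, ((u i : ℝ) + half (TB C) i) ^ 2)
      = ∑ i ∈ Finset.range (C.card + 1), C.card.choose i • ((-1) ^ i * J H (TB (Cj i))) := by
  have hH' : ∀ C, Summable fun u => H (NB C u) := by
    intro C
    rw [← Phi.summable_iff]
    exact (hH C).congr fun u => by simp [Function.comp, NB_Phi]
  have hb := blocks H hH' C ∅ (Finset.disjoint_empty_right _)
  simp only [Finset.prod_empty, one_mul, Finset.union_empty] at hb
  rw [← Phi.tsum_eq, ← Phi.tsum_eq] at hb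
  simp only [NB_Phi_empty] at hb
  simp only [NB_Phi] at hb
  rw [hb]
  have hs0 : Summable fun u : Fin 16 → ℤ => H (∑ i, (u i : ℝ) ^ 2) := by
    refine (hH ∅).congr fun u => ?_
    rw [← NB_Phi, NB_Phi_empty]
  have hexp : ∀ u : Fin 16 → ℤ, (∏ b ∈ C, (1 - bs (Phi u b))) * H (∑ i, (u i : ℝ) ^ 2)
      = ∑ S ∈ C.powerset, (-1) ^ S.card * (chi (TB S) u * H (∑ i, (u i : ℝ) ^ 2)) := by
    intro u
    simp only [sub_eq_add_neg]
    rw [Finset.prod_one_add, Finset.sum_mul]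
    refine Finset.sum_congr rfl fun S _ => ?_
    rw [chi_TB, Finset.prod_neg, mul_assoc]
  simp only [hexp]
  rw [Summable.tsum_finsetSum fun S _ => (chi_summable H hs0 (TB S)).mul_left _]
  rw [← Finset.sum_powerset_apply_card (fun i => (-1 : ℝ) ^ i * J H (TB (Cj i)))]
  refine Finset.sum_congr rfl fun S _ => ?_
  rw [tsum_mul_left]
  congr 1
  refine J_card H _ _ ?_
  rw [TB_card, TB_card, Cj_card _ (by simpa using Finset.card_le_univ S)]

lemma odds_lt (u : Fin 16 → ℤ) : odds u < 17 := by
  have := Finset.card_le_univ (Finset.univ.filter fun i => Odd (u i))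
  simp only [Fintype.card_fin] at this
  unfold odds; omega

lemma odds_le (u : Fin 16 → ℤ) : (odds u : ℤ) ≤ ∑ i, u i ^ 2 := by
  unfold odds
  rw [Finset.card_filter]
  push_cast
  refine Finset.sum_le_sum fun i _ => ?_
  split_ifs with h
  · have : u i ≠ 0 := by rintro h0; simp [h0] at h
    have := sq_pos_of_ne_zero this
    omega
  · positivity

lemma sq_ge (u : Fin 16 → ℤ) (hu : u ≠ 0) (h : odds u = 0) : 3 ≤ ∑ i, u i ^ 2 := by
  obtain ⟨i, hi⟩ := Function.ne_iff.mp hu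
  have h1 : ¬ Odd (u i) := by
    intro ho
    have : i ∈ Finset.univ.filter fun i => Odd (u i) := by simp [ho]
    rw [Finset.card_eq_zero.mp h] at this
    simp at this
  obtain ⟨m, hm⟩ := Int.not_odd_iff_even.mp h1
  have h2 : u i ^ 2 ≤ ∑ i, u i ^ 2 :=
    Finset.single_le_sum (f := fun i => u i ^ 2) (fun i _ => sq_nonneg _) (Finset.mem_univ i)
  have hm0 : m ≠ 0 := by rintro rfl; exact hi (by simpa using hm)
  have := sq_pos_of_ne_zero hm0
  rw [hm] at h2
  nlinarith

/-- The weighted theta sum of a profile. -/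
lemma theta_hasSum (G : ℝ → ℝ) (hG : Summable fun u : Fin 16 → ℤ => G (∑ i, (u i : ℝ) ^ 2)) :
    HasSum (fun u : Fin 16 → ℤ => ((WZ (odds u) : ℝ) / 80080) * G (∑ i, (u i : ℝ) ^ 2))
      (J G (TB (Cj 0)) - 2 * J G (TB (Cj 1)) + 9 / 8 * J G (TB (Cj 2)) + 7 / 4 * J G (TB (Cj 3))
        - 7 / 8 * J G (TB (Cj 4))) := by
  have h : ∀ j ≤ 4, HasSum (fun u : Fin 16 → ℤ => (Kr (4 * j) (odds u) : ℝ) * G (∑ i, (u i : ℝ) ^ 2))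
      ((Nat.choose 16 (4 * j) : ℝ) * J G (TB (Cj j))) := by
    intro j hj
    have := J_avg G hG (TB (Cj j))
    rwa [TB_card, Cj_card j hj] at this
  have h0 := h 0 (by norm_num)
  have h1 := (h 1 (by norm_num)).mul_left (1 / 910)
  have h2 := (h 2 (by norm_num)).mul_left (1 / 11440)
  have h3 := (h 3 (by norm_num)).mul_left (1 / 1040)
  have h4 := (h 4 (by norm_num)).mul_left (7 / 8)
  have c1 : Nat.choose 16 4 = 1820 := by decide
  have c2 : Nat.choose 16 8 = 12870 := by decide +kernel
  have c3 : Nat.choose 16 12 = 1820 := by decide +kernel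
  have hh := (((h0.sub h1).add h2).add h3).sub h4
  have c4 : Nat.choose 16 0 = 1 := by decide
  have c5 : Nat.choose 16 16 = 1 := by decide +kernel
  have hfun : (fun u : Fin 16 → ℤ => ((WZ (odds u) : ℝ) / 80080) * G (∑ i, (u i : ℝ) ^ 2)) = _ :=
    funext fun u => show _ = (fun b : Fin 16 → ℤ =>
      (Kr (4 * 0) (odds b) : ℝ) * G (∑ i, (b i : ℝ) ^ 2)
        - 1 / 910 * ((Kr (4 * 1) (odds b) : ℝ) * G (∑ i, (b i : ℝ) ^ 2))
        + 1 / 11440 * ((Kr (4 * 2) (odds b) : ℝ) * G (∑ i, (b i : ℝ) ^ 2))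
        + 1 / 1040 * ((Kr (4 * 3) (odds b) : ℝ) * G (∑ i, (b i : ℝ) ^ 2))
        - 7 / 8 * ((Kr (4 * 4) (odds b) : ℝ) * G (∑ i, (b i : ℝ) ^ 2))) u by
      simp only [WZ, Nat.reduceMul]
      push_cast
      ring
  rw [hfun]
  simp only [Nat.reduceMul, c1, c2, c3, c4, c5] at hh
  push_cast at hh
  have hv : J G (TB (Cj 0)) - 2 * J G (TB (Cj 1)) + 9 / 8 * J G (TB (Cj 2))
      + 7 / 4 * J G (TB (Cj 3)) - 7 / 8 * J G (TB (Cj 4))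
      = 1 * J G (TB (Cj 0)) - 1 / 910 * (1820 * J G (TB (Cj 1)))
        + 1 / 11440 * (12870 * J G (TB (Cj 2))) + 1 / 1040 * (1820 * J G (TB (Cj 3)))
        - 7 / 8 * (1 * J G (TB (Cj 4))) := by ring
  rw [hv]
  exact hh

theorem main (f : SchwartzMap E16 ℂ)
    (hradial : ∀ x y : E16, ‖x‖ = ‖y‖ → f x = f y)
    (hfhat : ∀ y, 0 ≤ ((𝓕 ⇑f) y).re)
    (hneg : ∀ x, Real.sqrt 3 ≤ ‖x‖ → (f x).re ≤ 0) :
    ((𝓕 ⇑f) 0).re ≤ (f 0).re := by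
  have hr := fourier_radial f hradial
  set G := prof f with hGdef
  set H := prof (𝓕 ⇑f) with hHdef
  have sG : Summable fun u : Fin 16 → ℤ => G (∑ i, (u i : ℝ) ^ 2) := by
    simpa using prof_summable f hradial 0
  have sH : ∀ x : Fin 16 → ℝ, Summable fun u : Fin 16 → ℤ => H (∑ i, ((u i : ℝ) + x i) ^ 2) :=
    fun x => prof_summable (𝓕 f : SchwartzMap E16 ℂ) hr x
  have sH0 : Summable fun u : Fin 16 → ℤ => H (∑ i, (u i : ℝ) ^ 2) := by
    simpa using sH 0
  have key : ∀ j ≤ 4, J G (TB (Cj j))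
      = ∑ i ∈ Finset.range (j + 1), j.choose i • ((-1) ^ i * J H (TB (Cj i))) := by
    intro j hj
    have h1 := poisson_prof f hradial (TB (Cj j))
    have h2 := dual_side H (fun C => sH _) (Cj j)
    rw [Cj_card j hj] at h2
    rw [← h2, J, ← h1]
  have k0 := key 0 (by norm_num)
  have k1 := key 1 (by norm_num)
  have k2 := key 2 (by norm_num)
  have k3 := key 3 (by norm_num)
  have k4 := key 4 (by norm_num)
  have c42 : Nat.choose 4 2 = 6 := rfl
  have c32 : Nat.choose 3 2 = 3 := rfl
  have c43 : Nat.choose 4 3 = 4 := rfl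
  simp [Finset.sum_range_succ, c42, c32, c43] at k0 k1 k2 k3 k4
  have tG := theta_hasSum G sG
  have tH := theta_hasSum H sH0
  have hGp : ∀ x : E16, (f x).re = G (‖x‖ ^ 2) := prof_eq f hradial
  have hHp : ∀ x : E16, ((𝓕 ⇑f) x).re = H (‖x‖ ^ 2) := prof_eq _ hr
  have hHnn : ∀ t, 0 ≤ H t := fun t => hfhat _
  have hGneg : ∀ t, 3 ≤ t → G t ≤ 0 := by
    intro t ht
    apply hneg
    rw [norm_smul, Real.norm_of_nonneg (Real.sqrt_nonneg _)]
    simpa using Real.sqrt_le_sqrt ht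
  obtain ⟨w1, w2, w3, w4⟩ := WZ_vals
  have ho0 : odds 0 = 0 := by simp [odds]
  have lower : H 0 ≤ J H (TB (Cj 0)) - 2 * J H (TB (Cj 1)) + 9 / 8 * J H (TB (Cj 2))
      + 7 / 4 * J H (TB (Cj 3)) - 7 / 8 * J H (TB (Cj 4)) := by
    have := tH.summable.le_tsum 0 (fun u _ => mul_nonneg
      (div_nonneg (by exact_mod_cast w1 _ (odds_lt u)) (by norm_num)) (hHnn _))
    rw [tH.tsum_eq, ho0, w2] at this
    simpa using this
  have upper : J G (TB (Cj 0)) - 2 * J G (TB (Cj 1)) + 9 / 8 * J G (TB (Cj 2))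
      + 7 / 4 * J G (TB (Cj 3)) - 7 / 8 * J G (TB (Cj 4)) ≤ G 0 := by
    have h1 := (hasSum_ite_eq (0 : Fin 16 → ℤ) (G 0))
    refine hasSum_le (fun u => ?_) tG h1
    split_ifs with hu
    · subst hu
      rw [ho0, w2]; simp
    · have hw : (0:ℝ) ≤ (WZ (odds u) : ℝ) / 80080 :=
        div_nonneg (by exact_mod_cast w1 _ (odds_lt u)) (by norm_num)
      have hcase : odds u = 1 ∨ odds u = 2 ∨ 3 ≤ ∑ i, u i ^ 2 := by
        by_cases h0 : odds u = 0
        · exact Or.inr (Or.inr (sq_ge u hu h0))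
        · have := odds_le u
          omega
      rcases hcase with h | h | h
      · simp [h, w3]
      · simp [h, w4]
      · refine mul_nonpos_of_nonneg_of_nonpos hw (hGneg _ ?_)
        exact_mod_cast h
  rw [hGp, hHp]
  simp only [norm_zero, ne_eq, OfNat.ofNat_ne_zero, not_false_eq_true, zero_pow]
  linarith

end LP16

/-- **The LP bound in `ℝ¹⁶` is at least `3⁸/2¹⁶`.**
Every radial real-valued Schwartz function `f` on `ℝ¹⁶` with `𝓕f ≥ 0` everywhere,
`𝓕f(0) > 0`, and `f(x) ≤ 0` for `‖x‖ ≥ √3` satisfies `f(0) ≥ 𝓕f(0)`; equivalently,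
`(f(0)/𝓕f(0))·(√3/2)¹⁶ ≥ 3⁸/2¹⁶`. -/
theorem lp_bound_dim16_lower
    (f : SchwartzMap (EuclideanSpace ℝ (Fin 16)) ℂ)
    (hradial : ∀ x y : EuclideanSpace ℝ (Fin 16), ‖x‖ = ‖y‖ → f x = f y)
    (hreal : ∀ x, (f x).im = 0)
    (hfhat : ∀ y, 0 ≤ ((𝓕 ⇑f) y).re ∧ ((𝓕 ⇑f) y).im = 0)
    (hfhat0 : 0 < ((𝓕 ⇑f) 0).re)
    (hneg : ∀ x, Real.sqrt 3 ≤ ‖x‖ → (f x).re ≤ 0) :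
    ((𝓕 ⇑f) 0).re ≤ (f 0).re ∧
      (3 : ℝ) ^ 8 / 2 ^ 16 ≤ (f 0).re / ((𝓕 ⇑f) 0).re * (Real.sqrt 3 / 2) ^ 16 := by
  have h1 : ((𝓕 ⇑f) 0).re ≤ (f 0).re := LP16.main f hradial (fun y => (hfhat y).1) hneg
  refine ⟨h1, ?_⟩
  have h2 : (Real.sqrt 3 / 2) ^ 16 = (3 : ℝ) ^ 8 / 2 ^ 16 := by
    rw [div_pow, show (16 : ℕ) = 2 * 8 from rfl, pow_mul (Real.sqrt 3), Real.sq_sqrt (by norm_num)]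
  rw [h2]
  exact le_mul_of_one_le_left (by positivity) ((one_le_div hfhat0).mpr h1)
end
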